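/- Let f be a fake μ. Suppose ℓ ≥ 1 is an integer, a_1,…,a_{2ℓ} are integers with a_j ≥ 0 for 1 ≤ j ≤ ℓ−1 and a_ℓ < 0, and (η_j)_{j≥2ℓ+1} are real numbers with |η_j| ≤ (A j)^B for some constants A, B > 0, such that for all s with Re s > 1: D_f(s) = U(s) · ∏_{j=1}^{2ℓ} ζ(js)^{a_j}, where U(s) = ∏_p (1 + Σ_{j≥2ℓ+1} η_j p^{−js}). Then there exists a nontrivial zero ρ of ζ with Re ρ ≥ 1/2 such that U(ρ/ℓ) ≠ 0 and ζ(jρ/ℓ) ≠ 0 for every integer 1 ≤ j ≤ 2ℓ with j ≠ ℓ. -/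

import Mathlib

open Complex

lemma Complex.card_zeros_le_of_norm_le {c : ℂ} {r R M : ℝ} {f : ℂ → ℂ} (hr : 0 < r) (hrR : r < R)
    (hM : 1 ≤ M) (hf : AnalyticOnNhd ℂ f (Metric.closedBall c R)) (hc : f c ≠ 0)
    (hbound : ∀ z ∈ Metric.sphere c R, ‖f z‖ ≤ M) (S : Finset ℂ)
    (hS : ∀ z ∈ S, z ∈ Metric.closedBall c r ∧ f z = 0) :
    (S.card : ℝ) ≤ Real.log (M / ‖f c‖) / Real.log (R / r) := by
  have hR : 0 < R := hr.trans hrR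
  have hJ := AnalyticOnNhd.sum_divisor_le (c := c) (r := r) (R := R) (M := M) (f := f)
    (abs_pos.2 hr.ne') (by rwa [abs_of_pos hr, abs_of_pos hR]) hM (by rwa [abs_of_pos hR]) hc
    (by rwa [abs_of_pos hR])
  rw [abs_of_pos hr] at hJ
  refine le_trans ?_ hJ
  have hf' : AnalyticOnNhd ℂ f (Metric.closedBall c r) :=
    hf.mono (Metric.closedBall_subset_closedBall hrR.le)
  have hfin := (MeromorphicOn.divisor f (Metric.closedBall c r)).finiteSupport
    (isCompact_closedBall c r)
  have hone : ∀ z ∈ S, 1 ≤ MeromorphicOn.divisor f (Metric.closedBall c r) z := by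
    intro z hz
    obtain ⟨hz1, hz2⟩ := hS z hz
    rw [MeromorphicOn.AnalyticOnNhd.divisor_apply hf' hz1]
    have h0 : analyticOrderAt f z ≠ 0 := (hf' z hz1).analyticOrderAt_ne_zero.2 hz2
    have htop : analyticOrderAt f z ≠ ⊤ := by
      refine hf'.analyticOrderAt_ne_top_of_isPreconnected (x := c)
        (convex_closedBall c r).isPreconnected (Metric.mem_closedBall_self hr.le) hz1 ?_
      rw [(hf' c (Metric.mem_closedBall_self hr.le)).analyticOrderAt_eq_zero.2 hc]
      simp
    obtain ⟨n, hn⟩ := ENat.ne_top_iff_exists.1 htop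
    rw [← hn] at h0 ⊢
    have hn0 : n ≠ 0 := by exact_mod_cast h0
    simp only [ENat.map_natCast, WithTop.untop₀_coe]
    omega
  have hnn := MeromorphicOn.AnalyticOnNhd.divisor_nonneg hf'
  have hsub : S ⊆ hfin.toFinset := by
    intro z hz
    simp only [Set.Finite.mem_toFinset, Function.mem_support]
    have := hone z hz
    omega
  have : (S.card : ℤ) ≤ ∑ᶠ u, MeromorphicOn.divisor f (Metric.closedBall c r) u := by
    rw [finsum_eq_sum_of_support_subset (s := hfin.toFinset) _ (by simp)]
    calc (S.card : ℤ) = ∑ _z ∈ S, (1 : ℤ) := by simp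
      _ ≤ ∑ z ∈ S, MeromorphicOn.divisor f (Metric.closedBall c r) z := Finset.sum_le_sum hone
      _ ≤ _ := Finset.sum_le_sum_of_subset_of_nonneg hsub (fun z _ _ => hnn z)
  exact_mod_cast this

/-- A nonvanishing holomorphic function on a disc has a holomorphic logarithm. -/
lemma Complex.exists_log_of_ne_zero_on_ball {F : ℂ → ℂ} {c : ℂ} {R : ℝ} (hR : 0 < R)
    (hF : DifferentiableOn ℂ F (Metric.ball c R)) (h0 : ∀ z ∈ Metric.ball c R, F z ≠ 0) :
    ∃ h : ℂ → ℂ, DifferentiableOn ℂ h (Metric.ball c R) ∧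
      ∀ z ∈ Metric.ball c R, exp (h z) = F z := by
  have hd : DifferentiableOn ℂ (fun z => deriv F z / F z) (Metric.ball c R) :=
    (hF.deriv Metric.isOpen_ball).div hF h0
  obtain ⟨h, hh⟩ := hd.isExactOn_ball
  have hcc : c ∈ Metric.ball c R := Metric.mem_ball_self hR
  refine ⟨fun z => h z - h c + log (F c), fun z hz =>
    (((hh z hz).differentiableAt.sub_const _).add_const _).differentiableWithinAt, ?_⟩
  have hconst : ∀ z ∈ Metric.ball c R,
      F z * exp (-(h z - h c + log (F c))) = F c * exp (-(h c - h c + log (F c))) := by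
    intro z hz
    refine Metric.isOpen_ball.is_const_of_deriv_eq_zero (convex_ball c R).isPreconnected
      (f := fun z => F z * exp (-(h z - h c + log (F c)))) ?_ ?_ hz hcc
    · refine hF.mul (DifferentiableOn.cexp ?_)
      exact fun w hw =>
        (((hh w hw).differentiableAt.sub_const _).add_const _).neg.differentiableWithinAt
    · intro w hw
      have h1 := (hF.differentiableAt (Metric.isOpen_ball.mem_nhds hw)).hasDerivAt
      have h2 := ((((hh w hw).sub_const (h c)).add_const (log (F c))).neg).cexp
      have := (h1.mul h2).deriv
      change deriv (fun z => F z * exp (-(h z - h c + log (F c)))) w = 0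
      refine Eq.trans this ?_
      have := h0 w hw
      field_simp
      ring
  intro z hz
  have := hconst z hz
  rw [sub_self, zero_add, exp_neg, exp_neg, exp_log (h0 c hcc), mul_inv_cancel₀ (h0 c hcc)] at this
  have hne := exp_ne_zero (h z - h c + log (F c))
  field_simp at this
  exact this.symm

lemma Complex.norm_le_three_circles {k : ℂ → ℂ} {r₁ r₂ a b : ℝ} (h1 : 0 < r₁) (h12 : r₁ < r₂)
    (hk : DifferentiableOn ℂ k (Metric.closedBall 0 r₂))
    (ha : ∀ z, ‖z‖ = r₁ → ‖k z‖ ≤ a) (hb : ∀ z, ‖z‖ = r₂ → ‖k z‖ ≤ b)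
    {z : ℂ} (hz1 : r₁ ≤ ‖z‖) (hz2 : ‖z‖ ≤ r₂) :
    ‖k z‖ ≤ a ^ (1 - (Real.log ‖z‖ - Real.log r₁) / (Real.log r₂ - Real.log r₁)) *
      b ^ ((Real.log ‖z‖ - Real.log r₁) / (Real.log r₂ - Real.log r₁)) := by
  have hz0 : 0 < ‖z‖ := h1.trans_le hz1
  have hzne : z ≠ 0 := norm_pos_iff.1 hz0
  have hr2 : 0 < r₂ := h1.trans h12
  have hball : ∀ w : ℂ, w.re ≤ Real.log r₂ → exp w ∈ Metric.closedBall (0 : ℂ) r₂ := by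
    intro w hw
    rw [mem_closedBall_zero_iff, norm_exp]
    exact (Real.le_log_iff_exp_le hr2).1 hw
  have hdiff : DifferentiableOn ℂ (fun w => k (exp w)) {w | w.re ≤ Real.log r₂} :=
    hk.comp differentiable_exp.differentiableOn hball
  have hl : Real.log r₁ < Real.log r₂ := Real.log_lt_log h1 h12
  obtain ⟨C, hC⟩ := (isCompact_closedBall (0 : ℂ) r₂).exists_bound_of_continuousOn hk.continuousOn
  have := HadamardThreeLines.norm_le_interp_of_mem_verticalClosedStrip' (f := fun w => k (exp w))
    (z := log z) (a := a) (b := b) hl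
    (by
      simp only [HadamardThreeLines.verticalClosedStrip, Set.mem_preimage, log_re, Set.mem_Icc]
      exact ⟨Real.log_le_log h1 hz1, Real.log_le_log hz0 hz2⟩)
    (by
      refine (hdiff.mono ?_).diffContOnCl
      rw [HadamardThreeLines.verticalStrip, closure_preimage_re, closure_Ioo hl.ne]
      exact fun w hw => hw.2)
    (by
      refine ⟨C, ?_⟩
      rintro _ ⟨w, hw, rfl⟩
      exact hC _ (hball w hw.2))
    (by
      intro w hw
      apply ha
      simp only [Set.mem_preimage, Set.mem_singleton_iff] at hw
      rw [norm_exp, hw, Real.exp_log h1])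
    (by
      intro w hw
      apply hb
      simp only [Set.mem_preimage, Set.mem_singleton_iff] at hw
      rw [norm_exp, hw, Real.exp_log hr2])
  simpa only [exp_log hzne, log_re] using this

/-- Smallness of `log ‖F‖` on a small disc propagates to a larger disc on which `F` does not vanish,
relative to an upper bound for `log ‖F‖`. -/
lemma Complex.abs_log_norm_le_propagate {r₀ r R ε : ℝ} (h0 : 0 < r₀) (h0r : r₀ < r) (hrR : r < R)
    (hε : 0 < ε) : ∃ η > 0, ∀ (M : ℝ) (F : ℂ → ℂ) (c : ℂ), 0 < M →
      DifferentiableOn ℂ F (Metric.ball c R) → (∀ z ∈ Metric.ball c R, F z ≠ 0) →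
      (∀ z ∈ Metric.ball c R, Real.log ‖F z‖ ≤ M) →
      (∀ z ∈ Metric.ball c r₀, |Real.log ‖F z‖| ≤ η * M) →
      ∀ z ∈ Metric.ball c r, |Real.log ‖F z‖| ≤ ε * M := by
  have hr : 0 < r := h0.trans h0r
  have hR : 0 < R := hr.trans hrR
  set r' := (r + R) / 2 with hr'
  have hrr' : r < r' := by rw [hr']; linarith
  have hr'R : r' < R := by rw [hr']; linarith
  set K : ℝ := max 1 (4 * r' / (R - r')) with hK
  have hK1 : 1 ≤ K := le_max_left _ _
  set Λ : ℝ := Real.log r' - Real.log (r₀ / 2) with hΛ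
  have hΛpos : 0 < Λ := sub_pos.2 (Real.log_lt_log (by positivity) (by linarith))
  set θ : ℝ := (Real.log r - Real.log (r₀ / 2)) / Λ with hθ
  have hθ1 : θ < 1 := by
    rw [hθ, div_lt_one hΛpos, hΛ]
    have := Real.log_lt_log hr hrr'
    linarith
  set x : ℝ := (ε / (2 * K)) ^ (1 / (1 - θ)) with hx
  have hxpos : 0 < x := by positivity
  refine ⟨min (min 1 x / 4) (min (ε / 2) 1), by positivity, ?_⟩
  set η := min (min 1 x / 4) (min (ε / 2) 1) with hη
  have hη0 : 0 < η := by positivity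
  have hη1 : 4 * η ≤ 1 := by
    have := min_le_left (min 1 x / 4) (min (ε / 2) 1)
    have := min_le_left 1 x
    linarith
  have hη2 : 4 * η ≤ x := by
    have := min_le_left (min 1 x / 4) (min (ε / 2) 1)
    have := min_le_right 1 x
    linarith
  have hη3 : η ≤ ε / 2 := (min_le_right _ _).trans (min_le_left _ _)
  have hη4 : η ≤ 1 := (min_le_right _ _).trans (min_le_right _ _)
  have hpow : (4 * η) ^ (1 - θ) * K ≤ ε / 2 := by
    have h1 : (4 * η) ^ (1 - θ) ≤ x ^ (1 - θ) :=
      Real.rpow_le_rpow (by positivity) hη2 (by linarith)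
    rw [hx, ← Real.rpow_mul (by positivity), one_div, inv_mul_cancel₀ (by linarith),
      Real.rpow_one] at h1
    calc (4 * η) ^ (1 - θ) * K ≤ ε / (2 * K) * K := by gcongr
      _ = ε / 2 := by field_simp
  intro M F c hM hF hne hup hsmall z hz
  by_cases hzs : z ∈ Metric.ball c r₀
  · refine (hsmall z hzs).trans ?_
    gcongr
    linarith
  obtain ⟨h, hh, hexp⟩ := exists_log_of_ne_zero_on_ball hR hF hne
  have hre : ∀ w ∈ Metric.ball c R, (h w).re = Real.log ‖F w‖ := by
    intro w hw
    rw [← hexp w hw, norm_exp, Real.log_exp]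
  have hmem : ∀ w : ℂ, ∀ t : ℝ, c + w ∈ Metric.ball c t ↔ ‖w‖ < t := by
    intro w t
    simp [Metric.mem_ball, dist_eq_norm]
  have hcR : c ∈ Metric.ball c R := Metric.mem_ball_self hR
  have hc0 := abs_le.1 (hsmall c (Metric.mem_ball_self h0))
  set k : ℂ → ℂ := fun w => h (c + w) - h c with hk
  have hkd : DifferentiableOn ℂ k (Metric.ball 0 R) := by
    refine DifferentiableOn.sub_const (hh.comp (by fun_prop) ?_) _
    intro w hw
    rw [mem_ball_zero_iff] at hw
    exact (hmem w R).2 hw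
  have hkre : ∀ w : ℂ, ‖w‖ < R → (k w).re = Real.log ‖F (c + w)‖ - Real.log ‖F c‖ := by
    intro w hw
    rw [hk, sub_re, hre _ ((hmem w R).2 hw), hre c hcR]
  have hηM : η * M ≤ M := by nlinarith
  have hbig : ∀ w : ℂ, ‖w‖ = r' → ‖k w‖ ≤ K * M := by
    intro w hw
    have hwR : ‖w‖ < R := by rw [hw]; exact hr'R
    have := borelCaratheodory_zero (f := k) (M := 2 * M) (R := R) (z := w) (by positivity) hkd
      (by
        intro v hv
        rw [mem_ball_zero_iff] at hv
        simp only [Set.mem_ofPred_eq]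
        rw [hkre v hv]
        have := hup _ ((hmem v R).2 hv)
        linarith [hc0.1]) hR (by rwa [mem_ball_zero_iff]) (by simp [hk])
    rw [hw] at this
    calc ‖k w‖ ≤ 2 * (2 * M) * r' / (R - r') := this
      _ = (4 * r' / (R - r')) * M := by ring
      _ ≤ K * M := by gcongr; exact le_max_right _ _
  have hlit : ∀ w : ℂ, ‖w‖ = r₀ / 2 → ‖k w‖ ≤ 4 * η * M := by
    intro w hw
    have := borelCaratheodory_zero (f := k) (M := 2 * (η * M)) (R := r₀) (z := w) (by positivity)
      (hkd.mono (Metric.ball_subset_ball (h0r.trans hrR).le))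
      (by
        intro v hv
        rw [mem_ball_zero_iff] at hv
        simp only [Set.mem_ofPred_eq]
        rw [hkre v (hv.trans (h0r.trans hrR))]
        have := abs_le.1 (hsmall _ ((hmem v r₀).2 hv))
        linarith [hc0.1, this.2]) h0 (by rw [mem_ball_zero_iff, hw]; linarith) (by simp [hk])
    rw [hw] at this
    calc ‖k w‖ ≤ 2 * (2 * (η * M)) * (r₀ / 2) / (r₀ - r₀ / 2) := this
      _ = 4 * η * M := by field_simp; ring
  set w := z - c with hw
  have hzw : z = c + w := by rw [hw]; ring
  have hwr : ‖w‖ < r := by rw [hzw] at hz; exact (hmem w r).1 hz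
  have hwr0 : r₀ ≤ ‖w‖ := by
    rw [hzw] at hzs
    exact not_lt.1 (fun hlt => hzs ((hmem w r₀).2 hlt))
  have hthree := norm_le_three_circles (k := k) (r₁ := r₀ / 2) (r₂ := r') (a := 4 * η * M)
    (b := K * M) (by positivity) (by linarith)
    (hkd.mono (Metric.closedBall_subset_ball hr'R)) hlit hbig (z := w) (by linarith) (by linarith)
  set τ : ℝ := (Real.log ‖w‖ - Real.log (r₀ / 2)) / (Real.log r' - Real.log (r₀ / 2)) with hτ
  have hτθ : τ ≤ θ := by
    rw [hτ, hθ]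
    gcongr
    linarith
  have hτ0 : 0 ≤ τ := by
    rw [hτ]
    refine div_nonneg (sub_nonneg.2 (Real.log_le_log (by positivity) (by linarith))) hΛpos.le
  have hkw : ‖k w‖ ≤ ε / 2 * M := by
    calc ‖k w‖ ≤ (4 * η * M) ^ (1 - τ) * (K * M) ^ τ := hthree
      _ = (4 * η) ^ (1 - τ) * K ^ τ * (M ^ (1 - τ) * M ^ τ) := by
        rw [Real.mul_rpow (by positivity) hM.le, Real.mul_rpow (by positivity) hM.le]; ring
      _ = (4 * η) ^ (1 - τ) * K ^ τ * M := by
        rw [← Real.rpow_add hM, sub_add_cancel, Real.rpow_one]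
      _ ≤ (4 * η) ^ (1 - θ) * K * M := by
        have h1 : (4 * η) ^ (1 - τ) ≤ (4 * η) ^ (1 - θ) :=
          Real.rpow_le_rpow_of_exponent_ge (by positivity) hη1 (by linarith)
        have h2 : K ^ τ ≤ K := by
          calc K ^ τ ≤ K ^ (1 : ℝ) := Real.rpow_le_rpow_of_exponent_le hK1 (by linarith)
            _ = K := Real.rpow_one K
        gcongr
      _ ≤ ε / 2 * M := by gcongr
  have hlog : Real.log ‖F z‖ = (k w).re + Real.log ‖F c‖ := by
    rw [hkre w (hwr.trans hrR), ← hzw]; ring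
  have h3 := abs_le.1 ((abs_re_le_norm (k w)).trans hkw)
  have h4 : η * M ≤ ε / 2 * M := by gcongr
  rw [hlog, abs_le]
  constructor <;> linarith [h3.1, h3.2, hc0.1, hc0.2]

open MeasureTheory Set Filter Topology in
theorem integrableOn_Ioi_fract_mul_cpow {s : ℂ} (hs : 0 < s.re) {N : ℝ} (hN : 0 < N) :
    IntegrableOn (fun t : ℝ ↦ ((Int.fract t : ℝ) : ℂ) * (t : ℂ) ^ (-(s + 1))) (Ioi N) := by
  have h : IntegrableOn (fun t : ℝ ↦ t ^ (-(s.re + 1))) (Ioi N) :=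
    integrableOn_Ioi_rpow_of_lt (by linarith) hN
  refine Integrable.mono' h ?_ ?_
  · exact (by fun_prop : Measurable (fun t : ℝ ↦ ((Int.fract t : ℝ) : ℂ) *
      (t : ℂ) ^ (-(s + 1)))).aestronglyMeasurable
  · filter_upwards [ae_restrict_mem measurableSet_Ioi] with t ht
    have ht0 : 0 < t := hN.trans ht
    rw [norm_mul, norm_cpow_eq_rpow_re_of_pos ht0, Complex.norm_real, Real.norm_eq_abs,
      abs_of_nonneg (Int.fract_nonneg t)]
    simp only [neg_re, add_re, one_re]
    exact mul_le_of_le_one_left (by positivity) (Int.fract_lt_one t).le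

open MeasureTheory Set Filter Topology in
theorem norm_integral_Ioi_fract_mul_cpow_le {s : ℂ} (hs : 0 < s.re) {N : ℝ} (hN : 0 < N) :
    ‖∫ t in Ioi N, ((Int.fract t : ℝ) : ℂ) * (t : ℂ) ^ (-(s + 1))‖ ≤ N ^ (-s.re) / s.re := by
  have h : IntegrableOn (fun t : ℝ ↦ t ^ (-(s.re + 1))) (Ioi N) :=
    integrableOn_Ioi_rpow_of_lt (by linarith) hN
  calc _ ≤ ∫ t in Ioi N, t ^ (-(s.re + 1)) := by
        refine norm_integral_le_of_norm_le h ?_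
        filter_upwards [ae_restrict_mem measurableSet_Ioi] with t ht
        have ht0 : 0 < t := hN.trans ht
        rw [norm_mul, norm_cpow_eq_rpow_re_of_pos ht0, Complex.norm_real, Real.norm_eq_abs,
          abs_of_nonneg (Int.fract_nonneg t)]
        simp only [neg_re, add_re, one_re]
        exact mul_le_of_le_one_left (by positivity) (Int.fract_lt_one t).le
    _ = N ^ (-s.re) / s.re := by
        rw [integral_Ioi_rpow_of_lt (by linarith) hN]
        rw [show -(s.re + 1) + 1 = -s.re by ring, neg_div_neg_eq]

open MeasureTheory Set Filter Topology in
theorem differentiableAt_integral_Ioi_one_fract_mul_cpow {s : ℂ} (hs : 0 < s.re) :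
    DifferentiableAt ℂ
      (fun s : ℂ ↦ ∫ t in Ioi (1 : ℝ), ((Int.fract t : ℝ) : ℂ) * (t : ℂ) ^ (-(s + 1))) s := by
  set g : ℝ → ℂ := (Ioi (1 : ℝ)).indicator (fun t ↦ ((Int.fract t : ℝ) : ℂ)) with hg
  have hgb : ∀ t, ‖g t‖ ≤ 1 := by
    intro t
    rw [hg, indicator]
    split_ifs
    · rw [Complex.norm_real, Real.norm_eq_abs, abs_of_nonneg (Int.fract_nonneg t)]
      exact (Int.fract_lt_one t).le
    · simp
  have hgm : Measurable g := (by fun_prop : Measurable fun t : ℝ ↦ ((Int.fract t : ℝ) : ℂ)).indicator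
    measurableSet_Ioi
  have key : DifferentiableAt ℂ (mellin g) (-s) := by
    refine mellin_differentiableAt_of_isBigO_rpow (a := 0) (b := -s.re - 1) ?_ ?_ ?_ ?_ ?_
    · refine ((locallyIntegrable_const (1 : ℝ)).mono hgm.aestronglyMeasurable ?_).locallyIntegrableOn _
      exact Eventually.of_forall fun t ↦ by simpa using hgb t
    · refine Asymptotics.IsBigO.of_bound 1 (Eventually.of_forall fun t ↦ ?_)
      simpa using hgb t
    · simpa using hs
    · refine Asymptotics.IsBigO.of_bound 1 ?_
      filter_upwards [mem_nhdsWithin_of_mem_nhds (Iio_mem_nhds (zero_lt_one' ℝ))] with t ht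
      have : g t = 0 := by
        rw [hg, indicator_of_notMem]
        simpa using le_of_lt ht
      simp only [this, norm_zero]; positivity
    · simp
  have h2 : DifferentiableAt ℂ (fun s ↦ mellin g (-s)) s := key.comp s differentiableAt_id.neg
  refine h2.congr_of_eventuallyEq (Eventually.of_forall fun z ↦ ?_)
  show _ = mellin g (-z)
  rw [mellin]
  have : ∀ t : ℝ, (t : ℂ) ^ (-z - 1) • g t = (Ioi (1 : ℝ)).indicator
      (fun t : ℝ ↦ ((Int.fract t : ℝ) : ℂ) * (t : ℂ) ^ (-(z + 1))) t := by
    intro t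
    rw [hg]
    simp only [indicator]
    split_ifs
    · rw [smul_eq_mul, mul_comm]; congr 2; ring
    · simp
  simp_rw [this]
  rw [setIntegral_indicator measurableSet_Ioi, Ioi_inter_Ioi]
  simp

open MeasureTheory Set Filter Topology in
theorem riemannZeta_eq_of_one_lt_re {s : ℂ} (hs : 1 < s.re) :
    riemannZeta s = s / (s - 1) -
      s * ∫ t in Ioi (1 : ℝ), ((Int.fract t : ℝ) : ℂ) * (t : ℂ) ^ (-(s + 1)) := by
  have h := LSeries_eq_mul_integral' (fun _ ↦ (1 : ℂ)) (r := 1) zero_le_one hs ?_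
  · have e : LSeries (fun _ ↦ (1 : ℂ)) s = riemannZeta s := LSeries_one_eq_riemannZeta hs
    rw [e] at h
    rw [h]
    have hs1 : s - 1 ≠ 0 := fun h0 ↦ by
      rw [sub_eq_zero] at h0; simp [h0] at hs
    have hInt : IntegrableOn (fun t : ℝ ↦ (t : ℂ) ^ (-s)) (Ioi 1) :=
      integrableOn_Ioi_cpow_of_lt (by simpa using hs) one_pos
    have e2 : ∫ t in Ioi (1 : ℝ), (∑ k ∈ Finset.Icc 1 ⌊t⌋₊, (1 : ℂ)) * (t : ℂ) ^ (-(s + 1)) =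
        (∫ t in Ioi (1 : ℝ), (t : ℂ) ^ (-s)) -
        ∫ t in Ioi (1 : ℝ), ((Int.fract t : ℝ) : ℂ) * (t : ℂ) ^ (-(s + 1)) := by
      rw [← integral_sub hInt (integrableOn_Ioi_fract_mul_cpow (by linarith) one_pos)]
      refine setIntegral_congr_fun measurableSet_Ioi fun t ht ↦ ?_
      have ht0 : (0 : ℝ) < t := one_pos.trans ht
      have htc : (t : ℂ) ≠ 0 := by exact_mod_cast ht0.ne'
      have hfl : ((⌊t⌋₊ : ℕ) : ℂ) = (t : ℂ) - ((Int.fract t : ℝ) : ℂ) := by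
        rw [← ofReal_sub, Int.self_sub_fract, ← natCast_floor_eq_intCast_floor ht0.le]; simp
      have hc : (t : ℂ) ^ (-s) = t * (t : ℂ) ^ (-(s + 1)) := by
        rw [show -s = 1 + -(s + 1) by ring, cpow_add _ _ htc, cpow_one]
      simp only [Finset.sum_const, Nat.card_Icc, Nat.add_sub_cancel, nsmul_eq_mul, mul_one]
      rw [hfl, hc]; ring
    rw [e2, integral_Ioi_cpow_of_lt (by simpa using hs) one_pos]
    have : -s + 1 ≠ 0 := by rw [show -s + 1 = -(s - 1) by ring]; exact neg_ne_zero.mpr hs1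
    simp only [ofReal_one, one_cpow]
    field_simp
    ring
  · refine Asymptotics.IsBigO.of_bound 1 (Eventually.of_forall fun n ↦ ?_)
    simp

open MeasureTheory Set Filter Topology in
theorem riemannZeta_eq_sub_integral_fract {s : ℂ} (hs : 0 < s.re) (hs1 : s ≠ 1) :
    riemannZeta s = s / (s - 1) -
      s * ∫ t in Ioi (1 : ℝ), ((Int.fract t : ℝ) : ℂ) * (t : ℂ) ^ (-(s + 1)) := by
  set E : ℂ → ℂ := fun s ↦ ∫ t in Ioi (1 : ℝ), ((Int.fract t : ℝ) : ℂ) * (t : ℂ) ^ (-(s + 1)) with hE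
  have hopen : IsOpen {z : ℂ | 0 < z.re} := isOpen_lt continuous_const continuous_re
  have hpre : IsPreconnected {z : ℂ | 0 < z.re} := (convex_halfSpace_re_gt 0).isPreconnected
  have hd : DifferentiableOn ℂ (fun s ↦ s - s * (s - 1) * E s) {z : ℂ | 0 < z.re} := by
    intro z hz
    have := differentiableAt_integral_Ioi_one_fract_mul_cpow hz
    have h3 : DifferentiableAt ℂ (fun s ↦ s - s * (s - 1) * E s) z := by
      rw [hE]; fun_prop
    exact h3.differentiableWithinAt
  have heq : EqOn riemannZeta₁ (fun s ↦ s - s * (s - 1) * E s) {z : ℂ | 0 < z.re} := by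
    refine AnalyticOnNhd.eqOn_of_preconnected_of_eventuallyEq
      (differentiable_riemannZeta₁.differentiableOn.analyticOnNhd hopen)
      (hd.analyticOnNhd hopen) hpre (z₀ := 2) (by simp) ?_
    have : {z : ℂ | 1 < z.re} ∈ 𝓝 (2 : ℂ) :=
      (isOpen_lt continuous_const continuous_re).mem_nhds (by simp)
    filter_upwards [this] with z hz
    have hz1 : z ≠ 1 := by rintro rfl; simp at hz
    have hz2 : z - 1 ≠ 0 := sub_ne_zero.mpr hz1
    have h1 := riemannZeta_eq_inv_sub_mul hz1
    rw [riemannZeta_eq_of_one_lt_re hz] at h1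
    have h2 : riemannZeta₁ z = (z - 1) * ((z - 1)⁻¹ * riemannZeta₁ z) := by field_simp
    rw [h2, ← h1]
    field_simp
    rfl
  have hz2 : s - 1 ≠ 0 := sub_ne_zero.mpr hs1
  rw [riemannZeta_eq_inv_sub_mul hs1, heq hs]
  field_simp
  rfl

theorem norm_riemannZeta_le_of_quarter_le_re {s : ℂ} (hs : 1 / 4 ≤ s.re) (ht : 1 ≤ |s.im|) :
    ‖riemannZeta s‖ ≤ 5 * ‖s‖ := by
  have hs0 : 0 < s.re := by linarith
  have hs1 : s ≠ 1 := by rintro rfl; simp at ht; linarith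
  rw [riemannZeta_eq_sub_integral_fract hs0 hs1]
  have h1 : 1 ≤ ‖s - 1‖ := ht.trans (by simpa using abs_im_le_norm (s - 1))
  have h2 := norm_integral_Ioi_fract_mul_cpow_le hs0 one_pos
  rw [Real.one_rpow] at h2
  have h3 : 1 / s.re ≤ 4 := by rw [div_le_iff₀ hs0]; linarith
  have h4 : ‖s / (s - 1)‖ ≤ ‖s‖ := by
    rw [norm_div]; exact div_le_self (norm_nonneg _) h1
  calc _ ≤ ‖s / (s - 1)‖ + ‖s‖ * _ := (norm_sub_le _ _).trans (by rw [norm_mul])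
    _ ≤ ‖s‖ + ‖s‖ * 4 := by gcongr; exact h2.trans h3
    _ = 5 * ‖s‖ := by ring

namespace Complex

theorem norm_Gamma_one_add_mul_I_sq_mul_sinh (y : ℝ) :
    ‖Gamma (1 + y * I)‖ ^ 2 * Real.sinh (Real.pi * y) = Real.pi * y := by
  rcases eq_or_ne y 0 with rfl | hy
  · simp
  have hyI : (y : ℂ) * I ≠ 0 := by simp [hy]
  have h1 : Gamma (1 + y * I) = y * I * Gamma (y * I) := by
    rw [add_comm, Gamma_add_one _ hyI]
  have h2 := Gamma_mul_Gamma_one_sub (y * I)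
  have h3 : Gamma (1 - y * I) = (starRingEnd ℂ) (Gamma (1 + y * I)) := by
    rw [← Gamma_conj]; congr 1; simp [sub_eq_add_neg]
  have h4 : sin (Real.pi * (y * I)) = Real.sinh (Real.pi * y) * I := by
    rw [← mul_assoc, sin_mul_I]; push_cast; ring
  have hsh : (Real.sinh (Real.pi * y) : ℂ) ≠ 0 := by
    rw [ofReal_ne_zero, Ne, Real.sinh_eq_zero]
    exact mul_ne_zero Real.pi_ne_zero hy
  have h5 : Gamma (1 + y * I) * (starRingEnd ℂ) (Gamma (1 + y * I)) *
      Real.sinh (Real.pi * y) = Real.pi * y := by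
    rw [← h3]
    conv_lhs => rw [h1]
    rw [mul_assoc (_ * I), h2, h4]
    field_simp
  rw [mul_conj, normSq_eq_norm_sq] at h5
  exact_mod_cast h5

theorem norm_Gamma_le_of_re_lt_two {s : ℂ} (h0 : 0 < s.re) (h2 : s.re < 2) :
    ‖Gamma s‖ ≤ Real.Gamma s.re * ‖1 + s.im * I‖ * ‖Gamma (1 + s.im * I)‖ := by
  set b : ℂ := ((2 - s.re : ℝ) : ℂ)
  have hb : 0 < b.re := by simp [b]; linarith
  have e1 := Gamma_mul_Gamma_eq_betaIntegral h0 hb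
  have e2 := Gamma_mul_Gamma_eq_betaIntegral (s := (s.re : ℂ)) (by simpa using h0) hb
  have e3 : s + b = (1 + s.im * I) + 1 := by
    apply Complex.ext <;> simp [b] ; ring
  have e4 : (s.re : ℂ) + b = (1 : ℕ) + 1 := by
    simp [b]; ring
  have hn : 1 + (s.im : ℂ) * I ≠ 0 := by
    intro h; simpa using congrArg re h
  rw [e3, Gamma_add_one _ hn] at e1
  rw [e4, Gamma_nat_eq_factorial] at e2
  simp only [Nat.factorial_one, Nat.cast_one, one_mul] at e2
  have hInt := betaIntegral_convergent (u := (s.re : ℂ)) (by simpa using h0) hb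
  have hle : ‖betaIntegral s b‖ ≤ ‖betaIntegral (s.re : ℂ) b‖ := by
    have hre : betaIntegral (s.re : ℂ) b =
        ((∫ x : ℝ in 0..1, x ^ (s.re - 1) * (1 - x) ^ (b.re - 1) : ℝ) : ℂ) := by
      rw [betaIntegral, ← intervalIntegral.integral_ofReal,
        intervalIntegral.integral_of_le zero_le_one, intervalIntegral.integral_of_le zero_le_one,
        MeasureTheory.integral_Ioc_eq_integral_Ioo, MeasureTheory.integral_Ioc_eq_integral_Ioo]
      refine MeasureTheory.setIntegral_congr_fun measurableSet_Ioo fun x hx ↦ ?_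
      have : (0 : ℝ) ≤ 1 - x := by linarith [hx.2]
      simp only [b, ofReal_re]
      push_cast [ofReal_cpow hx.1.le, ofReal_cpow this]
      rfl
    have hInt' : IntervalIntegrable (fun x : ℝ ↦ x ^ (s.re - 1) * (1 - x) ^ (b.re - 1))
        MeasureTheory.volume 0 1 := by
      rw [intervalIntegrable_iff_integrableOn_Ioo_of_le zero_le_one] at hInt ⊢
      refine MeasureTheory.IntegrableOn.congr_fun hInt.norm (fun x hx ↦ ?_) measurableSet_Ioo
      have : (0 : ℝ) < 1 - x := by linarith [hx.2]
      simp only [norm_mul]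
      rw [norm_cpow_eq_rpow_re_of_pos hx.1,
        show (1 : ℂ) - x = ((1 - x : ℝ) : ℂ) by push_cast; rfl, norm_cpow_eq_rpow_re_of_pos this]
      simp
    rw [hre, norm_real]
    refine le_trans ?_ (le_abs_self _)
    rw [betaIntegral]
    refine intervalIntegral.norm_integral_le_of_norm_le zero_le_one ?_ hInt'
    have hne : ∀ᵐ x : ℝ, x ≠ 1 := by
      simp [MeasureTheory.ae_iff]
    filter_upwards [hne] with x hx1 hx
    have : (0 : ℝ) < 1 - x := by
      have := lt_of_le_of_ne hx.2 hx1; linarith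
    rw [norm_mul, norm_cpow_eq_rpow_re_of_pos hx.1,
      show (1 : ℂ) - x = ((1 - x : ℝ) : ℂ) by push_cast; rfl, norm_cpow_eq_rpow_re_of_pos this]
    simp
  have hgb : 0 < ‖Gamma b‖ := norm_pos_iff.mpr (Gamma_ne_zero_of_re_pos hb)
  have hgx : ‖Gamma (s.re : ℂ)‖ = Real.Gamma s.re := by
    rw [Gamma_ofReal, norm_real, Real.norm_of_nonneg (Real.Gamma_pos_of_pos h0).le]
  refine le_of_mul_le_mul_right ?_ hgb
  calc ‖Gamma s‖ * ‖Gamma b‖ = ‖1 + s.im * I‖ * ‖Gamma (1 + s.im * I)‖ * ‖betaIntegral s b‖ := by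
        rw [← norm_mul, e1, norm_mul, norm_mul]
    _ ≤ ‖1 + s.im * I‖ * ‖Gamma (1 + s.im * I)‖ * (Real.Gamma s.re * ‖Gamma b‖) := by
        gcongr; rw [← hgx, ← norm_mul, e2]; exact hle
    _ = _ := by ring

theorem norm_cos_le_cosh (z : ℂ) : ‖cos z‖ ≤ Real.cosh z.im := by
  rw [cos, norm_div, Real.cosh_eq]
  have h1 : ‖exp (z * I)‖ = Real.exp (-z.im) := by rw [norm_exp]; simp
  have h2 : ‖exp (-z * I)‖ = Real.exp (z.im) := by rw [norm_exp]; simp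
  have : ‖(2 : ℂ)‖ = 2 := by simp
  rw [this]
  gcongr
  refine (norm_add_le _ _).trans ?_
  rw [h1, h2, add_comm]

end Complex

theorem Real.cosh_le_two_mul_sinh {x : ℝ} (hx : 1 ≤ x) : cosh x ≤ 2 * sinh x := by
  have h1 : 1 + x ≤ exp x := by linarith [Real.add_one_le_exp x]
  have h2 : exp x * exp (-x) = 1 := by rw [← Real.exp_add]; simp
  have h3 := Real.exp_pos (-x)
  rw [cosh_eq, sinh_eq]
  nlinarith

theorem norm_Gamma_mul_cosh_le {y : ℝ} (hy : 1 ≤ |y|) :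
    ‖Gamma (1 + y * I)‖ * Real.cosh (Real.pi * y / 2) ≤ 4 * |y| := by
  have h := norm_Gamma_one_add_mul_I_sq_mul_sinh y
  have hpi := Real.pi_gt_three
  have hpi4 := Real.pi_le_four
  have h' : ‖Gamma (1 + y * I)‖ ^ 2 * Real.sinh (Real.pi * |y|) = Real.pi * |y| := by
    rcases abs_cases y with ⟨h1, _⟩ | ⟨h1, _⟩
    · rw [h1, h]
    · rw [h1, mul_neg, Real.sinh_neg]; linarith
  have hc : Real.cosh (Real.pi * y / 2) = Real.cosh (Real.pi * |y| / 2) := by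
    rw [← Real.cosh_abs, abs_div, abs_mul, abs_of_pos Real.pi_pos, abs_two]
  rw [hc]
  set x := Real.pi * |y| / 2 with hx
  have e : Real.pi * |y| = 2 * x := by rw [hx]; ring
  rw [e, Real.sinh_two_mul] at h'
  have hx1 : 1 ≤ x := by rw [hx]; nlinarith
  have h3 := Real.cosh_le_two_mul_sinh hx1
  have hcp := Real.cosh_pos x
  have h4 : (‖Gamma (1 + y * I)‖ * Real.cosh x) ^ 2 ≤ 2 * x := by
    have : ‖Gamma (1 + y * I)‖ ^ 2 * Real.cosh x * (2 * Real.sinh x - Real.cosh x) ≥ 0 := by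
      have : 0 ≤ 2 * Real.sinh x - Real.cosh x := by linarith
      positivity
    nlinarith
  have h5 : 2 * x ≤ (4 * |y|) ^ 2 := by rw [hx]; nlinarith
  exact le_of_sq_le_sq (h4.trans h5) (by positivity)

theorem exists_norm_riemannZeta_le_of_re_le_quarter :
    ∃ C : ℝ, 0 < C ∧ ∀ s : ℂ, -(1 / 2) ≤ s.re → s.re ≤ 1 / 4 → 1 ≤ |s.im| →
      ‖riemannZeta s‖ ≤ C * |s.im| ^ 3 := by
  obtain ⟨G, hG⟩ := isCompact_Icc.exists_bound_of_continuousOn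
    (s := Set.Icc (3 / 4 : ℝ) (3 / 2)) (f := Real.Gamma)
    (fun x hx ↦ (Real.differentiableAt_Gamma fun m ↦ by
      have := hx.1; have : (0 : ℝ) ≤ m := by positivity
      intro h; linarith).continuousAt.continuousWithinAt)
  have hG0 : 0 ≤ G := (norm_nonneg _).trans (hG 1 (by norm_num))
  refine ⟨2 * ((G + 1) * 2 * 4) * 15, by positivity, fun z h1 h2 hy ↦ ?_⟩
  set s : ℂ := 1 - z with hs
  have hsre : s.re = 1 - z.re := by simp [hs]
  have hsim : s.im = -z.im := by simp [hs]
  have hy' : 1 ≤ |s.im| := by rwa [hsim, abs_neg]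
  have hsn : ∀ n : ℕ, s ≠ -n := fun n h ↦ by
    have := congrArg im h; simp at this; rw [this] at hy'; simp at hy'; linarith
  have hs1 : s ≠ 1 := fun h ↦ by rw [h] at hy'; simp at hy'; linarith
  have hz : z = 1 - s := by simp [hs]
  have hGs : ‖Gamma s‖ ≤ (G + 1) * (2 * |s.im|) * ‖Gamma (1 + s.im * I)‖ := by
    refine (norm_Gamma_le_of_re_lt_two (by linarith) (by linarith)).trans ?_
    gcongr
    · exact (le_abs_self _).trans ((hG s.re ⟨by linarith, by linarith⟩).trans (by linarith))
    · refine (norm_add_le _ _).trans ?_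
      simp; linarith
  have hcos : ‖cos (Real.pi * s / 2)‖ ≤ Real.cosh (Real.pi * s.im / 2) := by
    have := norm_cos_le_cosh (Real.pi * s / 2)
    simpa using this
  have hpw : ‖(2 * Real.pi : ℂ) ^ (-s)‖ ≤ 1 := by
    have : (2 * Real.pi : ℂ) = ((2 * Real.pi : ℝ) : ℂ) := by push_cast; rfl
    rw [this, norm_cpow_eq_rpow_re_of_pos (by positivity)]
    exact Real.rpow_le_one_of_one_le_of_nonpos (by linarith [Real.pi_gt_three])
      (by simp; linarith)
  have hzs : ‖riemannZeta s‖ ≤ 15 * |s.im| := by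
    refine (norm_riemannZeta_le_of_quarter_le_re (by linarith) hy').trans ?_
    have : ‖s‖ ≤ |s.re| + |s.im| := norm_le_abs_re_add_abs_im s
    have : |s.re| ≤ 2 := abs_le.mpr ⟨by linarith, by linarith⟩
    linarith
  have hgc := norm_Gamma_mul_cosh_le hy'
  rw [hz, riemannZeta_one_sub hsn hs1]
  rw [norm_mul, norm_mul, norm_mul, norm_mul]
  have hyz : |(1 - s).im| = |s.im| := by simp
  rw [hyz]
  calc _ ≤ 2 * 1 * ((G + 1) * (2 * |s.im|) * ‖Gamma (1 + s.im * I)‖) *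
        Real.cosh (Real.pi * s.im / 2) * (15 * |s.im|) := by
        gcongr; simp
    _ = 2 * ((G + 1) * (2 * |s.im|)) * (‖Gamma (1 + s.im * I)‖ *
        Real.cosh (Real.pi * s.im / 2)) * (15 * |s.im|) := by ring
    _ ≤ 2 * ((G + 1) * (2 * |s.im|)) * (4 * |s.im|) * (15 * |s.im|) := by gcongr
    _ = _ := by ring

theorem norm_riemannZeta_I_mul_ge {T : ℝ} (hT : 1 ≤ T) :
    T * ‖riemannZeta (1 + T * I)‖ ^ 2 ≤ 16 * ‖riemannZeta (T * I)‖ ^ 2 := by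
  set s : ℂ := 1 + (-T : ℝ) * I with hs
  have hsim : s.im = -T := by simp [hs]
  have hsn : ∀ n : ℕ, s ≠ -n := fun n h ↦ by
    have := congrArg im h; simp [hsim] at this; linarith
  have hs1 : s ≠ 1 := fun h ↦ by
    have := congrArg im h; simp [hsim] at this; linarith
  have h1 : 1 - s = T * I := by simp [hs]
  have hc : riemannZeta s = (starRingEnd ℂ) (riemannZeta (1 + T * I)) := by
    rw [← riemannZeta_conj]; congr 1; simp [hs]
  have hfe := riemannZeta_one_sub hsn hs1
  have hpw : ‖(2 * Real.pi : ℂ) ^ (-s)‖ = (2 * Real.pi)⁻¹ := by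
    have : (2 * Real.pi : ℂ) = ((2 * Real.pi : ℝ) : ℂ) := by push_cast; rfl
    rw [this, norm_cpow_eq_rpow_re_of_pos (by positivity)]
    simp [hs, Real.rpow_neg_one]
  have hcos : ‖cos (Real.pi * s / 2)‖ = Real.sinh (Real.pi * T / 2) := by
    have : (Real.pi * s / 2 : ℂ) = Real.pi / 2 - ((Real.pi * T / 2 : ℝ) : ℂ) * I := by
      rw [hs]; push_cast; ring
    rw [this, cos_pi_div_two_sub, sin_mul_I, ← ofReal_sinh, norm_mul, norm_I, mul_one, norm_real]
    exact Real.norm_of_nonneg (Real.sinh_nonneg_iff.mpr (by positivity))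
  have hg := norm_Gamma_one_add_mul_I_sq_mul_sinh (-T)
  rw [mul_neg, Real.sinh_neg, mul_neg, neg_inj] at hg
  rw [h1] at hfe
  rw [hfe]
  simp only [norm_mul, norm_ofNat]
  rw [hpw, hcos, hc, RCLike.norm_conj]
  set g := ‖Gamma s‖ with hgdef
  set z := ‖riemannZeta (1 + T * I)‖
  set x := Real.pi * T / 2 with hx
  have hpi := Real.pi_gt_three
  have hpi4 := Real.pi_le_four
  have hx1 : 1 ≤ x := by rw [hx]; nlinarith
  have h3 := Real.cosh_le_two_mul_sinh hx1
  have hsh : 0 < Real.sinh x := Real.sinh_pos_iff.mpr (by linarith)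
  have e : Real.pi * T = 2 * x := by rw [hx]; ring
  rw [e, Real.sinh_two_mul] at hg
  have h6 : 2 * x ≤ 4 * (g ^ 2 * Real.sinh x ^ 2) := by
    have : g ^ 2 * (2 * Real.sinh x * Real.cosh x) ≤
        g ^ 2 * (2 * Real.sinh x * (2 * Real.sinh x)) := by gcongr
    rw [hg] at this
    linarith
  have h7 : 16 * (2 * (2 * Real.pi)⁻¹ * g * Real.sinh x * z) ^ 2 =
      (Real.pi⁻¹) ^ 2 * 4 * (4 * (g ^ 2 * Real.sinh x ^ 2)) * z ^ 2 := by
    rw [mul_inv]; ring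
  rw [h7]
  have h8 : T ≤ (Real.pi⁻¹) ^ 2 * 4 * (2 * x) := by
    rw [← e]
    have : (Real.pi⁻¹) ^ 2 * 4 * (Real.pi * T) = 4 / Real.pi * T := by field_simp
    rw [this]
    have : 1 ≤ 4 / Real.pi := by rw [le_div_iff₀ Real.pi_pos]; linarith
    nlinarith
  gcongr
  exact h8.trans (by gcongr)

theorem norm_riemannZeta_sub_one_le {s : ℂ} (hs : 2 ≤ s.re) :
    ‖riemannZeta s - 1‖ ≤ 13 / 20 := by
  have h1 : 1 < s.re := by linarith
  have hsum : Summable fun n : ℕ ↦ (1 : ℂ) / ((n : ℂ) + 1) ^ s := by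
    have := (Complex.summable_one_div_nat_cpow (p := s)).mpr h1
    simpa using (summable_nat_add_iff 1).mpr this
  have hsum2 : Summable fun n : ℕ ↦ (1 : ℝ) / ((n : ℝ) + 1) ^ 2 := by
    simpa using (summable_nat_add_iff 1).mpr (Real.summable_one_div_nat_pow (p := 2) |>.mpr one_lt_two)
  have h2 : ∑' n : ℕ, (1 : ℝ) / ((n : ℝ) + 1) ^ 2 = Real.pi ^ 2 / 6 := by
    have := hasSum_zeta_two.tsum_eq
    rw [hasSum_zeta_two.summable.tsum_eq_zero_add] at this
    simpa using this
  rw [hsum2.tsum_eq_zero_add] at h2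
  rw [zeta_eq_tsum_one_div_nat_add_one_cpow h1, hsum.tsum_eq_zero_add]
  simp only [Nat.cast_zero, zero_add, one_cpow, div_one, add_sub_cancel_left, one_pow] at h2 ⊢
  have hle : ‖∑' n : ℕ, (1 : ℂ) / (((n + 1 : ℕ) : ℂ) + 1) ^ s‖ ≤
      ∑' n : ℕ, (1 : ℝ) / (((n + 1 : ℕ) : ℝ) + 1) ^ 2 := by
    refine tsum_of_norm_bounded ((summable_nat_add_iff 1).mpr hsum2).hasSum fun n ↦ ?_
    have hb : ((((n + 1 : ℕ) : ℂ)) + 1) = ((((n + 1 : ℕ) : ℝ) + 1 : ℝ) : ℂ) := by push_cast; rfl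
    rw [norm_div, norm_one, hb, norm_cpow_eq_rpow_re_of_pos (by positivity)]
    gcongr
    rw [← Real.rpow_natCast]
    exact Real.rpow_le_rpow_of_exponent_le (by push_cast; linarith [(n.cast_nonneg : (0 : ℝ) ≤ n)])
      (by simpa using hs)
  refine hle.trans ?_
  have : Real.pi < 3.1416 := Real.pi_lt_d4
  have : Real.pi ^ 2 < 9.87 := by nlinarith [Real.pi_pos]
  linarith

theorem exists_norm_riemannZeta_le_rpow :
    ∃ C : ℝ, 0 < C ∧ ∀ (T : ℝ) (s : ℂ), 2 ≤ T → -(1 / 2) ≤ s.re → s.re ≤ 10 → |s.im - T| ≤ 1 →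
      ‖riemannZeta s‖ ≤ C * T ^ 3 := by
  obtain ⟨C, hC, h⟩ := exists_norm_riemannZeta_le_of_re_le_quarter
  refine ⟨8 * C + 60, by positivity, fun T s hT h1 h2 h3 ↦ ?_⟩
  rw [abs_le] at h3
  have him : 1 ≤ s.im := by linarith
  have him' : |s.im| = s.im := abs_of_pos (by linarith)
  have hT3 : T ≤ T ^ 3 := le_self_pow₀ (by linarith) (by norm_num)
  have hT1 : 1 ≤ T ^ 3 := one_le_pow₀ (by linarith)
  rcases le_total s.re (1 / 4) with h4 | h4
  · refine (h s h1 h4 (by rwa [him'])).trans ?_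
    rw [him']
    have : s.im ^ 3 ≤ (2 * T) ^ 3 := by gcongr; linarith
    have : C * s.im ^ 3 ≤ C * (2 * T) ^ 3 := by gcongr
    nlinarith
  · refine (norm_riemannZeta_le_of_quarter_le_re h4 (by rwa [him'])).trans ?_
    have h5 : ‖s‖ ≤ |s.re| + |s.im| := norm_le_abs_re_add_abs_im s
    rw [him', abs_of_pos (by linarith)] at h5
    have : 0 ≤ C * T ^ 3 := by positivity
    nlinarith

theorem re_mem_Ioo_of_riemannZeta_eq_zero {s : ℂ} (h : riemannZeta s = 0) (him : s.im ≠ 0) :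
    0 < s.re ∧ s.re < 1 := by
  constructor
  · by_contra! hre
    set w : ℂ := 1 - s with hw
    have hwim : w.im ≠ 0 := by simpa [hw] using him
    have hwre : 1 ≤ w.re := by simp [hw]; linarith
    have hsn : ∀ n : ℕ, w ≠ -n := fun n h ↦ by
      have := congrArg im h; simp at this; exact hwim this
    have hs1 : w ≠ 1 := fun h ↦ by rw [h] at hwim; simp at hwim
    have hfe := riemannZeta_one_sub hsn hs1
    rw [show 1 - w = s by simp [hw], h] at hfe
    have hcos : cos (Real.pi * w / 2) ≠ 0 := by
      rw [Ne, cos_eq_zero_iff]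
      rintro ⟨k, hk⟩
      have := congrArg im hk
      have e : ((2 * k + 1) * Real.pi / 2 : ℂ) = (((2 * k + 1) * Real.pi / 2 : ℝ) : ℂ) := by
        push_cast; rfl
      rw [e, ofReal_im] at this
      simp [hwim, Real.pi_ne_zero] at this
    have hpi : (2 * Real.pi : ℂ) ^ (-w) ≠ 0 := by
      rw [cpow_ne_zero_iff]; left; simp [Real.pi_ne_zero]
    exact (mul_ne_zero (mul_ne_zero (mul_ne_zero (mul_ne_zero two_ne_zero hpi)
      (Gamma_ne_zero_of_re_pos (by linarith))) hcos)
      (riemannZeta_ne_zero_of_one_le_re hwre)) hfe.symm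
  · by_contra! hre
    exact riemannZeta_ne_zero_of_one_le_re hre h

theorem riemannZeta_one_sub_conj_eq_zero {s : ℂ} (h : riemannZeta s = 0) (him : s.im ≠ 0) :
    riemannZeta (1 - (starRingEnd ℂ) s) = 0 := by
  have him' : ((starRingEnd ℂ) s).im ≠ 0 := by simpa using him
  rw [riemannZeta_one_sub, riemannZeta_conj, h]
  · simp
  · intro n hn
    rw [hn] at him'; simp at him'
  · intro hn
    rw [hn] at him'; simp at him'

open Filter Topology in
/-- The vertical gaps between nontrivial zeros of the zeta function tend to zero. -/
theorem eventually_exists_riemannZeta_eq_zero_near {K : ℕ} (hK : 4 ≤ K) :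
    ∀ᶠ T : ℝ in atTop, ∃ ρ : ℂ, riemannZeta ρ = 0 ∧ |ρ.im - T| < 1 / K := by
  by_contra hbad
  have hK0 : (0 : ℝ) < K := by positivity
  set δ : ℝ := 1 / K with hδ
  have hδ0 : 0 < δ := by positivity
  have hδ4 : δ ≤ 1 / 4 := by
    rw [hδ]; gcongr; exact_mod_cast hK
  set P : ℝ → Prop := fun T ↦ ∃ ρ : ℂ, riemannZeta ρ = 0 ∧ |ρ.im - T| < δ with hP
  set F : Filter ℝ := atTop ⊓ 𝓟 {T | ¬ P T} with hF
  have hne : F.NeBot := by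
    rw [hF, ← frequently_mem_iff_neBot]
    exact not_eventually.mp hbad
  have hFtop : F ≤ atTop := inf_le_left
  have hFP : ∀ᶠ T in F, ¬ P T := by
    have : {T | ¬ P T} ∈ F := mem_inf_of_right (mem_principal_self _)
    exact this
  obtain ⟨C, hC, hζ⟩ := exists_norm_riemannZeta_le_rpow
  have hlog : Tendsto Real.log F atTop := Real.tendsto_log_atTop.mono_left hFtop
  have key : ∀ n : ℕ, n ≤ 12 * K → ∀ ε : ℝ, 0 < ε → ∀ᶠ T : ℝ in F,
      ∀ z ∈ Metric.ball ((3 - n * (δ / 4) : ℝ) + (T : ℂ) * I) (δ / 4),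
        |Real.log ‖riemannZeta z‖| ≤ ε * Real.log T := by
    intro n
    induction n with
    | zero =>
      intro _ ε hε
      filter_upwards [hlog.eventually_ge_atTop (2 / ε)] with T hT z hz
      rw [mem_ball_iff_norm] at hz
      have hre : 2 ≤ z.re := by
        have := (abs_re_le_norm _).trans hz.le
        simp at this
        rw [abs_le] at this; linarith
      have h1 := norm_riemannZeta_sub_one_le hre
      have h2 : ‖riemannZeta z‖ ≤ 2 := by
        have := norm_add_le (riemannZeta z - 1) 1
        simp at this; linarith
      have h3 : 1 / 4 ≤ ‖riemannZeta z‖ := by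
        have := norm_sub_norm_le (1 : ℂ) (1 - riemannZeta z)
        rw [norm_sub_rev 1] at this
        simp at this; linarith
      have h4 : 2 ≤ ε * Real.log T := by
        rw [div_le_iff₀ hε] at hT; linarith
      refine le_trans ?_ h4
      rw [abs_le]
      have hl2 : Real.log 2 ≤ 1 := by linarith [Real.log_two_lt_d9]
      constructor
      · have h5 := Real.log_le_log (by norm_num) h3
        have : Real.log (1 / 4 : ℝ) = -(2 * Real.log 2) := by
          rw [one_div, Real.log_inv, show (4 : ℝ) = 2 ^ 2 by norm_num, Real.log_pow]; simp
        linarith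
      · have := Real.log_le_log (by linarith) h2
        linarith
    | succ n ih =>
      intro hn ε hε
      have hn' : (n : ℝ) + 1 ≤ 12 * K := by exact_mod_cast hn
      have hKδ : K * δ = 1 := by rw [hδ]; field_simp
      have hcn : (δ / 4) ≤ 3 - n * (δ / 4) := by nlinarith
      have hcn3 : 3 - n * (δ / 4) ≤ 3 := by
        have : 0 ≤ n * (δ / 4) := by positivity
        linarith
      obtain ⟨η, hη, hprop⟩ := abs_log_norm_le_propagate (r₀ := δ / 4) (r := δ / 2) (R := δ)
        (ε := ε / 4) (by linarith) (by linarith) (by linarith) (by linarith)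
      filter_upwards [ih (by omega) (η * 4) (by positivity), hFP, (eventually_ge_atTop (2 : ℝ)).filter_mono hFtop,
        hlog.eventually_ge_atTop (Real.log C), hlog.eventually_ge_atTop 1] with T h1 h2 h3 h4 h5 z hz
      have hball : ∀ w ∈ Metric.ball ((3 - n * (δ / 4) : ℝ) + (T : ℂ) * I) δ,
          -(1 / 2) ≤ w.re ∧ w.re ≤ 10 ∧ |w.im - T| < δ := by
        intro w hw
        rw [mem_ball_iff_norm] at hw
        have a1 := (abs_re_le_norm _).trans_lt hw
        have a2 := (abs_im_le_norm _).trans_lt hw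
        simp at a1 a2
        rw [abs_lt] at a1
        exact ⟨by linarith, by linarith, a2⟩
      have hnz : ∀ w ∈ Metric.ball ((3 - n * (δ / 4) : ℝ) + (T : ℂ) * I) δ,
          riemannZeta w ≠ 0 := fun w hw h0 ↦ h2 ⟨w, h0, (hball w hw).2.2⟩
      have := hprop (4 * Real.log T) riemannZeta ((3 - n * (δ / 4) : ℝ) + (T : ℂ) * I)
        (by linarith) ?_ hnz ?_ ?_ z ?_
      · linarith
      · intro w hw
        refine (differentiableAt_riemannZeta ?_).differentiableWithinAt
        rintro rfl
        have := (hball 1 hw).2.2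
        rw [abs_lt] at this
        simp at this; linarith
      · intro w hw
        obtain ⟨b1, b2, b3⟩ := hball w hw
        have b4 := hζ T w h3 b1 b2 (by linarith)
        have b5 := Real.log_le_log (norm_pos_iff.mpr (hnz w hw)) b4
        rw [Real.log_mul hC.ne' (by positivity), Real.log_pow] at b5
        push_cast at b5; linarith
      · intro w hw
        have := h1 w hw
        linarith
      · rw [mem_ball_iff_norm] at hz ⊢
        have e : z - ((3 - n * (δ / 4) : ℝ) + (T : ℂ) * I) =
            (z - ((3 - (n + 1 : ℕ) * (δ / 4) : ℝ) + (T : ℂ) * I)) + ((-(δ / 4) : ℝ) : ℂ) := by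
          push_cast; ring
        rw [e]
        refine (norm_add_le _ _).trans_lt ?_
        rw [norm_real, norm_neg, Real.norm_of_nonneg (by linarith)]
        linarith
  have hKδ : K * δ = 1 := by rw [hδ]; field_simp
  have e0 := key (12 * K) le_rfl (1 / 8) (by norm_num)
  have e1 := key (8 * K) (by omega) (1 / 8) (by norm_num)
  obtain ⟨T, f0, f1, f2, f3, f4⟩ := (e0.and (e1.and (hFP.and
    (((eventually_ge_atTop (2 : ℝ)).filter_mono hFtop).and
      (hlog.eventually_gt_atTop (2 * Real.log 16)))))).exists
  have g0 := f0 (T * I) (by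
    have : (3 - ((12 * K : ℕ) : ℝ) * (δ / 4) : ℝ) = 0 := by push_cast; linarith
    rw [this]; simp [hδ0])
  have g1 := f1 (1 + T * I) (by
    have : (3 - ((8 * K : ℕ) : ℝ) * (δ / 4) : ℝ) = 1 := by push_cast; linarith
    rw [this]; simp [hδ0])
  have n0 : 0 < ‖riemannZeta (T * I)‖ :=
    norm_pos_iff.mpr fun h ↦ f2 ⟨_, h, by simpa using hδ0⟩
  have n1 : 0 < ‖riemannZeta (1 + T * I)‖ :=
    norm_pos_iff.mpr fun h ↦ f2 ⟨_, h, by simpa using hδ0⟩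
  have hT0 : 0 < T := by linarith
  have h := Real.log_le_log (by positivity) (norm_riemannZeta_I_mul_ge (by linarith : 1 ≤ T))
  rw [Real.log_mul hT0.ne' (by positivity), Real.log_mul (by norm_num) (by positivity),
    Real.log_pow, Real.log_pow] at h
  rw [abs_le] at g0 g1
  push_cast at h
  linarith

open MeasureTheory in
theorem lintegral_lintegral_mul_mul_le {g : ℝ → ℂ} (hg : Measurable g) {G : ℝ → ℝ}
    (hG : Measurable G) (hGs : ∀ x, G (-x) = G x) :
    ∫⁻ u, ∫⁻ v, ‖g u‖ₑ * ‖g v‖ₑ * ENNReal.ofReal (G (u - v)) ≤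
      (∫⁻ x, ENNReal.ofReal (G x)) * ∫⁻ u, ‖g u‖ₑ ^ 2 := by
  have hamgm : ∀ u v, ‖g u‖ₑ * ‖g v‖ₑ ≤ 2⁻¹ * (‖g u‖ₑ ^ 2 + ‖g v‖ₑ ^ 2) := by
    intro u v
    have h : 2 * (‖g u‖₊ * ‖g v‖₊) ≤ ‖g u‖₊ ^ 2 + ‖g v‖₊ ^ 2 := by
      have := two_mul_le_add_sq (‖g u‖₊) (‖g v‖₊); rwa [mul_assoc] at this
    rw [← ENNReal.div_eq_inv_mul, ENNReal.le_div_iff_mul_le (Or.inl (by simp)) (Or.inl (by simp)),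
      mul_comm, enorm_eq_nnnorm, enorm_eq_nnnorm]
    exact_mod_cast h
  have hGm : Measurable fun x ↦ ENNReal.ofReal (G x) := hG.ennreal_ofReal
  have e1 : ∀ u, ∫⁻ v, ENNReal.ofReal (G (u - v)) = ∫⁻ x, ENNReal.ofReal (G x) := fun u ↦
    lintegral_sub_left_eq_self (fun x ↦ ENNReal.ofReal (G x)) u
  have e2 : ∫⁻ u, ∫⁻ v, ‖g u‖ₑ ^ 2 * ENNReal.ofReal (G (u - v)) =
      (∫⁻ x, ENNReal.ofReal (G x)) * ∫⁻ u, ‖g u‖ₑ ^ 2 := by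
    rw [← lintegral_const_mul _ (by fun_prop)]
    refine lintegral_congr fun u ↦ ?_
    rw [lintegral_const_mul _ (by fun_prop), e1, mul_comm]
  have e3 : ∫⁻ u, ∫⁻ v, ‖g v‖ₑ ^ 2 * ENNReal.ofReal (G (u - v)) =
      (∫⁻ x, ENNReal.ofReal (G x)) * ∫⁻ u, ‖g u‖ₑ ^ 2 := by
    rw [lintegral_lintegral_swap (by fun_prop), ← e2]
    refine lintegral_congr fun u ↦ lintegral_congr fun v ↦ ?_
    rw [← hGs, neg_sub]
  calc _ ≤ ∫⁻ u, ∫⁻ v, 2⁻¹ * (‖g u‖ₑ ^ 2 * ENNReal.ofReal (G (u - v)) +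
        ‖g v‖ₑ ^ 2 * ENNReal.ofReal (G (u - v))) := by
        refine lintegral_mono fun u ↦ lintegral_mono fun v ↦ ?_
        rw [← add_mul, ← mul_assoc]
        exact mul_le_mul' (hamgm u v) le_rfl
    _ = 2⁻¹ * ((∫⁻ u, ∫⁻ v, ‖g u‖ₑ ^ 2 * ENNReal.ofReal (G (u - v))) +
        ∫⁻ u, ∫⁻ v, ‖g v‖ₑ ^ 2 * ENNReal.ofReal (G (u - v))) := by
        rw [← lintegral_add_left (by fun_prop), ← lintegral_const_mul _ (by fun_prop)]
        refine lintegral_congr fun u ↦ ?_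
        rw [lintegral_const_mul _ (by fun_prop), lintegral_add_left (by fun_prop)]
    _ = _ := by
        rw [e2, e3, ← two_mul, ← mul_assoc, ENNReal.inv_mul_cancel (by simp) (by simp), one_mul]

open MeasureTheory in
theorem lintegral_gaussian_mul_enorm_sq_le {g : ℝ → ℂ} (hg : Measurable g)
    (hgi : Integrable g) {b : ℝ} (hb : 0 < b) :
    ∫⁻ t : ℝ, ENNReal.ofReal (Real.exp (-b * t ^ 2)) * ‖∫ u : ℝ, cexp (-(t * u) * I) * g u‖ₑ ^ 2 ≤
      ENNReal.ofReal (2 * Real.pi) * ∫⁻ u, ‖g u‖ₑ ^ 2 := by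
  set G : ℝ → ℝ := fun x ↦ Real.sqrt (Real.pi / b) * Real.exp (-(1 / (4 * b)) * x ^ 2) with hG
  set H : ℝ → ℝ × ℝ → ℂ := fun t p ↦ cexp (-b * t ^ 2) * (g p.1 * (starRingEnd ℂ) (g p.2)) *
    cexp (-(t * (p.1 - p.2)) * I) with hH
  have hgauss : Integrable fun t : ℝ ↦ cexp (-b * t ^ 2) :=
    integrable_cexp_neg_mul_sq (by simpa using hb)
  have hconj : Integrable fun v ↦ (starRingEnd ℂ) (g v) := by
    refine hgi.norm.mono' (by fun_prop) (Filter.Eventually.of_forall fun v ↦ by simp)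
  have hHi : Integrable (Function.uncurry H) ((volume : Measure ℝ).prod (volume.prod volume)) := by
    have h1 := hgauss.mul_prod (hgi.mul_prod hconj)
    refine h1.mul_bdd (c := 1) (by fun_prop) (Filter.Eventually.of_forall fun p ↦ ?_)
    rw [norm_exp]
    simp
  have hHt : ∀ t, ∫ p, H t p ∂(volume.prod volume) =
      ((Real.exp (-b * t ^ 2) * ‖∫ u : ℝ, cexp (-(t * u) * I) * g u‖ ^ 2 : ℝ) : ℂ) := by
    intro t
    have e : ∀ p : ℝ × ℝ, H t p = cexp (-b * t ^ 2) * ((cexp (-(t * p.1) * I) * g p.1) *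
        (starRingEnd ℂ) (cexp (-(t * p.2) * I) * g p.2)) := by
      intro p
      have e1 : (starRingEnd ℂ) (cexp (-(t * p.2) * I)) = cexp (t * p.2 * I) := by
        rw [← exp_conj]; congr 1; simp
      have e2 : cexp (-(t * (p.1 - p.2)) * I) = cexp (-(t * p.1) * I) * cexp (t * p.2 * I) := by
        rw [← Complex.exp_add]; congr 1; ring
      simp only [hH]
      rw [map_mul, e1, e2]
      ring
    simp_rw [e]
    rw [integral_const_mul, integral_prod_mul
      (f := fun u : ℝ ↦ cexp (-(t * u) * I) * g u)
      (g := fun u : ℝ ↦ (starRingEnd ℂ) (cexp (-(t * u) * I) * g u)), integral_conj, mul_conj,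
      normSq_eq_norm_sq]
    push_cast; rfl
  have hHp : ∀ p : ℝ × ℝ, ∫ t, H t p = (g p.1 * (starRingEnd ℂ) (g p.2)) * (G (p.1 - p.2) : ℂ) := by
    intro p
    have := fourierIntegral_gaussian (b := (b : ℂ)) (by simpa using hb) (-(p.1 - p.2 : ℂ))
    have e : ∀ t : ℝ, H t p = (g p.1 * (starRingEnd ℂ) (g p.2)) *
        (cexp (I * -(p.1 - p.2 : ℂ) * t) * cexp (-b * t ^ 2)) := by
      intro t
      simp only [hH]
      rw [show I * -(p.1 - p.2 : ℂ) * t = -(t * (p.1 - p.2)) * I by ring]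
      ring
    simp_rw [e]
    rw [integral_const_mul, this]
    congr 1
    simp only [hG]
    push_cast
    congr 1
    · rw [Real.sqrt_eq_rpow, ofReal_cpow (by positivity)]; push_cast; rfl
    · congr 1; ring
  have hswap : ∫ t, ∫ p, H t p ∂(volume.prod volume) = ∫ p, ∫ t, H t p ∂volume ∂(volume.prod volume) :=
    integral_integral_swap hHi
  have hInt : Integrable fun t ↦ ∫ p, H t p ∂(volume.prod volume) := hHi.integral_prod_left
  set r : ℝ → ℝ := fun t ↦ Real.exp (-b * t ^ 2) * ‖∫ u : ℝ, cexp (-(t * u) * I) * g u‖ ^ 2 with hr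
  have hr0 : ∀ t, 0 ≤ r t := fun t ↦ by positivity
  have hri : Integrable r := by
    have := hInt.re
    refine this.congr (Filter.Eventually.of_forall fun t ↦ ?_)
    simp only [hHt]
    exact ofReal_re _
  have hGm : Measurable G := by simp only [hG]; fun_prop
  have hlhs : ∫⁻ t : ℝ, ENNReal.ofReal (Real.exp (-b * t ^ 2)) *
      ‖∫ u : ℝ, cexp (-(t * u) * I) * g u‖ₑ ^ 2 = ‖∫ t, ∫ p, H t p ∂(volume.prod volume)‖ₑ := by
    rw [show ∫ t, ∫ p, H t p ∂(volume.prod volume) = ((∫ t, r t : ℝ) : ℂ) from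
      (integral_congr_ae (Filter.Eventually.of_forall hHt)).trans integral_ofReal]
    have : ‖((∫ t, r t : ℝ) : ℂ)‖ₑ = ENNReal.ofReal (∫ t, r t) := by
      rw [← ofReal_norm, norm_real, Real.norm_of_nonneg (integral_nonneg hr0)]
    refine Eq.trans ?_ this.symm
    rw [ofReal_integral_eq_lintegral_ofReal hri (Filter.Eventually.of_forall hr0)]
    refine lintegral_congr fun t ↦ ?_
    simp only [hr]
    rw [ENNReal.ofReal_mul (by positivity), ENNReal.ofReal_pow (norm_nonneg _), ofReal_norm]
  rw [hlhs, hswap]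
  simp_rw [hHp]
  refine (enorm_integral_le_lintegral_enorm _).trans ?_
  have hmeas : Measurable fun p : ℝ × ℝ ↦
      ‖g p.1 * (starRingEnd ℂ) (g p.2) * (G (p.1 - p.2) : ℂ)‖ₑ :=
    (((hg.comp measurable_fst).mul (continuous_conj.measurable.comp
      (hg.comp measurable_snd))).mul (measurable_ofReal.comp
        (hGm.comp (measurable_fst.sub measurable_snd)))).enorm
  rw [lintegral_prod _ hmeas.aemeasurable]
  have hG0 : ∀ x, 0 ≤ G x := fun x ↦ by positivity
  have hGint : ∫⁻ x, ENNReal.ofReal (G x) = ENNReal.ofReal (2 * Real.pi) := by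
    have hi : Integrable G := (integrable_exp_neg_mul_sq (by positivity)).const_mul _
    rw [← ofReal_integral_eq_lintegral_ofReal hi (Filter.Eventually.of_forall hG0)]
    congr 1
    simp only [hG]
    rw [integral_const_mul, integral_gaussian, ← Real.sqrt_mul (by positivity),
      show Real.pi / b * (Real.pi / (1 / (4 * b))) = (2 * Real.pi) ^ 2 by field_simp; ring,
      Real.sqrt_sq (by positivity)]
  rw [← hGint]
  refine le_trans (le_of_eq ?_) (lintegral_lintegral_mul_mul_le hg hGm fun x ↦ by simp [hG])
  refine lintegral_congr fun u ↦ lintegral_congr fun v ↦ ?_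
  rw [enorm_mul, enorm_mul, RCLike.enorm_conj, ← ofReal_norm (G (u - v) : ℂ), norm_real,
    Real.norm_of_nonneg (hG0 _)]

open MeasureTheory Set in
theorem setLIntegral_enorm_fourier_sq_le {g : ℝ → ℂ} (hg : Measurable g)
    (hgi : Integrable g) {T : ℝ} (hT : 0 < T) :
    ∫⁻ t in Icc (-T) T, ‖∫ u : ℝ, cexp (-(t * u) * I) * g u‖ₑ ^ 2 ≤
      ENNReal.ofReal 20 * ∫⁻ u, ‖g u‖ₑ ^ 2 := by
  have h1 := lintegral_gaussian_mul_enorm_sq_le hg hgi (b := 1 / T ^ 2) (by positivity)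
  have h2 : ∀ t ∈ Icc (-T) T, (1 : ENNReal) ≤ ENNReal.ofReal 3 *
      ENNReal.ofReal (Real.exp (-(1 / T ^ 2) * t ^ 2)) := by
    intro t ht
    rw [← ENNReal.ofReal_mul (by norm_num), ← ENNReal.ofReal_one]
    refine ENNReal.ofReal_le_ofReal ?_
    have h3 : t ^ 2 ≤ T ^ 2 := sq_le_sq' ht.1 ht.2
    have h4 : Real.exp (-1) ≤ Real.exp (-(1 / T ^ 2) * t ^ 2) := by
      refine Real.exp_le_exp.mpr ?_
      have : 1 / T ^ 2 * t ^ 2 ≤ 1 := by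
        rw [one_div_mul_eq_div]; exact div_le_one_of_le₀ h3 (by positivity)
      linarith
    have h5 : 1 ≤ 3 * Real.exp (-1) := by
      have := Real.exp_one_lt_d9
      rw [Real.exp_neg, ← div_eq_mul_inv, le_div_iff₀ (Real.exp_pos _)]
      linarith
    linarith
  calc _ ≤ ∫⁻ t in Icc (-T) T, ENNReal.ofReal 3 * (ENNReal.ofReal (Real.exp (-(1 / T ^ 2) * t ^ 2)) *
        ‖∫ u : ℝ, cexp (-(t * u) * I) * g u‖ₑ ^ 2) := by
        refine setLIntegral_mono' measurableSet_Icc fun t ht ↦ ?_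
        rw [← mul_assoc]
        exact le_mul_of_one_le_left zero_le (h2 t ht)
    _ ≤ ∫⁻ t, ENNReal.ofReal 3 * (ENNReal.ofReal (Real.exp (-(1 / T ^ 2) * t ^ 2)) *
        ‖∫ u : ℝ, cexp (-(t * u) * I) * g u‖ₑ ^ 2) := setLIntegral_le_lintegral _ _
    _ ≤ ENNReal.ofReal 3 * (ENNReal.ofReal (2 * Real.pi) * ∫⁻ u, ‖g u‖ₑ ^ 2) := by
        rw [lintegral_const_mul' _ _ (by simp)]
        gcongr
    _ ≤ _ := by
        rw [← mul_assoc, ← ENNReal.ofReal_mul (by norm_num)]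
        gcongr
        linarith [Real.pi_lt_d2]

open MeasureTheory in
theorem integral_sub_translate_mul {𝕜 : Type*} [RCLike 𝕜] {ψ E : ℝ → 𝕜} {q : 𝕜} {h : ℝ}
    (hE : ∀ u, E u = q * E (u + h)) (hi : Integrable fun u ↦ ψ u * E u) :
    Integrable (fun u ↦ (ψ (u + h) - ψ u) * E u) ∧
      ∫ u, (ψ (u + h) - ψ u) * E u = (q - 1) * ∫ u, ψ u * E u := by
  have hi' : Integrable fun u ↦ q * (ψ (u + h) * E (u + h)) :=
    (hi.comp_add_right h).const_mul q
  have e : (fun u ↦ (ψ (u + h) - ψ u) * E u) =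
      fun u ↦ q * (ψ (u + h) * E (u + h)) - ψ u * E u := by
    funext u
    rw [sub_mul, hE u]
    ring
  rw [e]
  refine ⟨hi'.sub hi, ?_⟩
  rw [integral_sub hi' hi, integral_const_mul,
    integral_add_right_eq_self (fun u ↦ ψ u * E u) h]
  ring

/-- The function `u ↦ {exp u}` on the positive half-line, extended by zero. -/
noncomputable def fractExp (u : ℝ) : ℝ := if 0 < u then Int.fract (Real.exp u) else 0

/-- The function `u ↦ exp u + ⌊exp u⌋` on the positive half-line, extended by zero. -/
noncomputable def expAddFloorExp (u : ℝ) : ℝ :=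
  if 0 < u then Real.exp u + (⌊Real.exp u⌋ : ℝ) else 0

theorem measurable_fractExp : Measurable fractExp :=
  Measurable.ite measurableSet_Ioi (measurable_fract.comp Real.measurable_exp) measurable_const

theorem measurable_expAddFloorExp : Measurable expAddFloorExp :=
  Measurable.ite measurableSet_Ioi (by fun_prop) measurable_const

theorem fractExp_mem_Icc (u : ℝ) : fractExp u ∈ Set.Icc (0 : ℝ) 1 := by
  unfold fractExp
  split_ifs
  · exact ⟨Int.fract_nonneg _, (Int.fract_lt_one _).le⟩
  · simp

theorem expAddFloorExp_nonneg (u : ℝ) : 0 ≤ expAddFloorExp u := by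
  unfold expAddFloorExp
  split_ifs
  · have : (0 : ℝ) ≤ ⌊Real.exp u⌋ := by exact_mod_cast Int.floor_nonneg.mpr (Real.exp_pos u).le
    have := Real.exp_pos u
    linarith
  · simp

theorem abs_fractExp_sub_le {u v : ℝ} (huv : u ≤ v) :
    |fractExp v - fractExp u| ≤ expAddFloorExp v - expAddFloorExp u := by
  have h0 : Real.exp u ≤ Real.exp v := Real.exp_le_exp.mpr huv
  have h1 : (⌊Real.exp u⌋ : ℝ) ≤ ⌊Real.exp v⌋ := by exact_mod_cast Int.floor_mono h0
  have h2 : (0 : ℝ) ≤ ⌊Real.exp v⌋ := by exact_mod_cast Int.floor_nonneg.mpr (Real.exp_pos v).le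
  have h3 := Int.self_sub_floor (Real.exp u)
  have h4 := Int.self_sub_floor (Real.exp v)
  have h5 := Real.exp_pos v
  unfold fractExp expAddFloorExp
  rw [← h3, ← h4]
  split_ifs with hv hu hu
  · rw [abs_le]; constructor <;> linarith
  · rw [abs_le]; constructor <;> linarith
  · exact absurd (hu.trans_le huv) hv
  · simp

theorem sq_fractExp_sub_le {u v : ℝ} (huv : u ≤ v) :
    (fractExp v - fractExp u) ^ 2 ≤ expAddFloorExp v - expAddFloorExp u := by
  refine le_trans ?_ (abs_fractExp_sub_le huv)
  have h : |fractExp v - fractExp u| ≤ 1 := by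
    have := fractExp_mem_Icc u
    have := fractExp_mem_Icc v
    simp only [Set.mem_Icc] at *
    rw [abs_le]; constructor <;> linarith
  rw [← sq_abs, sq]
  exact mul_le_of_le_one_left (abs_nonneg _) h

open MeasureTheory Set in
theorem integrable_expAddFloorExp_mul_exp {c : ℝ} (hc : 1 < c) :
    Integrable (fun u ↦ expAddFloorExp u * Real.exp (-c * u)) ∧
      ∫ u, expAddFloorExp u * Real.exp (-c * u) ≤ 2 / (c - 1) := by
  have hb : Integrable ((Ioi (0 : ℝ)).indicator fun u ↦ 2 * Real.exp (-(c - 1) * u)) :=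
    IntegrableOn.integrable_indicator
      ((exp_neg_integrableOn_Ioi 0 (by linarith)).const_mul 2) measurableSet_Ioi
  have hle : ∀ u, expAddFloorExp u * Real.exp (-c * u) ≤
      (Ioi (0 : ℝ)).indicator (fun u ↦ 2 * Real.exp (-(c - 1) * u)) u := by
    intro u
    unfold expAddFloorExp
    by_cases hu : 0 < u
    · rw [if_pos hu, indicator_of_mem (mem_Ioi.mpr hu),
        show -(c - 1) * u = u + -c * u by ring, Real.exp_add, ← mul_assoc]
      have := Int.floor_le (Real.exp u)
      gcongr
      linarith
    · rw [if_neg hu, indicator_of_notMem (by simpa using hu)]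
      simp
  have hi : Integrable (fun u ↦ expAddFloorExp u * Real.exp (-c * u)) := by
    refine hb.mono' ?_ (Filter.Eventually.of_forall fun u ↦ ?_)
    · have := measurable_expAddFloorExp
      exact (by fun_prop : Measurable _).aestronglyMeasurable
    · rw [Real.norm_of_nonneg (mul_nonneg (expAddFloorExp_nonneg u) (Real.exp_pos _).le)]
      exact hle u
  refine ⟨hi, (integral_mono hi hb hle).trans (le_of_eq ?_)⟩
  rw [integral_indicator measurableSet_Ioi, integral_const_mul,
    integral_exp_mul_Ioi (by linarith)]
  rw [mul_zero, Real.exp_zero, neg_div_neg_eq, mul_one_div]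

open MeasureTheory Set in
theorem integral_fract_mul_cpow_eq {s : ℂ} (hs : 0 < s.re) :
    Integrable (fun u : ℝ ↦ (fractExp u : ℂ) * cexp (-s * u)) ∧
    ∫ t in Ioi (1 : ℝ), ((Int.fract t : ℝ) : ℂ) * (t : ℂ) ^ (-(s + 1)) =
      ∫ u : ℝ, (fractExp u : ℂ) * cexp (-s * u) := by
  constructor
  · have hb : Integrable ((Ioi (0 : ℝ)).indicator fun u ↦ Real.exp (-s.re * u)) :=
      (exp_neg_integrableOn_Ioi 0 hs).integrable_indicator measurableSet_Ioi
    refine hb.mono' ?_ (Filter.Eventually.of_forall fun u ↦ ?_)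
    · have := measurable_fractExp
      exact (by fun_prop : Measurable _).aestronglyMeasurable
    · rw [norm_mul, norm_exp, norm_real, Real.norm_of_nonneg (fractExp_mem_Icc u).1]
      have e : (-s * u).re = -s.re * u := by simp
      rw [e]
      by_cases hu : 0 < u
      · rw [indicator_of_mem (mem_Ioi.mpr hu)]
        exact mul_le_of_le_one_left (Real.exp_pos _).le (fractExp_mem_Icc u).2
      · rw [indicator_of_notMem (by simpa using hu)]
        simp [fractExp, hu]
  have him : Real.exp '' Ioi 0 = Ioi (1 : ℝ) := by
    ext x
    constructor
    · rintro ⟨u, hu, rfl⟩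
      exact Real.one_lt_exp_iff.mpr hu
    · intro hx
      exact ⟨Real.log x, Real.log_pos hx, Real.exp_log (zero_lt_one.trans hx)⟩
  rw [← him, integral_image_eq_integral_abs_deriv_smul (f' := Real.exp) measurableSet_Ioi
    (fun x _ ↦ (Real.hasDerivAt_exp x).hasDerivWithinAt) Real.exp_injective.injOn,
    ← integral_indicator measurableSet_Ioi]
  refine integral_congr_ae (Filter.Eventually.of_forall fun u ↦ ?_)
  beta_reduce
  by_cases hu : 0 < u
  · rw [indicator_of_mem (mem_Ioi.mpr hu), fractExp, if_pos hu, abs_of_pos (Real.exp_pos u),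
      cpow_def_of_ne_zero (by exact_mod_cast (Real.exp_pos u).ne'), ← ofReal_log (Real.exp_pos u).le,
      Real.log_exp, show (u : ℂ) * -(s + 1) = -s * u - u by ring, Complex.exp_sub, ← ofReal_exp,
      real_smul]
    have : ((Real.exp u : ℝ) : ℂ) ≠ 0 := by exact_mod_cast (Real.exp_pos u).ne'
    field_simp
  · rw [indicator_of_notMem (by simpa using hu)]
    simp [fractExp, hu]

open MeasureTheory Set in
theorem lintegral_enorm_fractExp_sub_sq_le {σ h : ℝ} (hσ : 1 / 2 < σ) (hh : 0 ≤ h) :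
    ∫⁻ u, ‖((fractExp (u + h) - fractExp u : ℝ) : ℂ) * cexp (-σ * u)‖ₑ ^ 2 ≤
      ENNReal.ofReal ((Real.exp (2 * σ * h) - 1) * (2 / (2 * σ - 1))) := by
  obtain ⟨hi, hle⟩ := integrable_expAddFloorExp_mul_exp (c := 2 * σ) (by linarith)
  obtain ⟨hd, he⟩ := integral_sub_translate_mul (ψ := expAddFloorExp)
    (E := fun u ↦ Real.exp (-(2 * σ) * u)) (q := Real.exp (2 * σ * h)) (h := h)
    (fun u ↦ by rw [← Real.exp_add]; congr 1; ring) hi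
  have h1 : (Real.exp (2 * σ * h) - 1) * ∫ u, expAddFloorExp u * Real.exp (-(2 * σ) * u) ≤
      (Real.exp (2 * σ * h) - 1) * (2 / (2 * σ - 1)) := by
    refine mul_le_mul_of_nonneg_left hle ?_
    have := Real.one_le_exp (x := 2 * σ * h) (by positivity)
    linarith
  refine le_trans ?_ (ENNReal.ofReal_le_ofReal h1)
  have hp : ∀ u, (fractExp (u + h) - fractExp u) ^ 2 * Real.exp (-(2 * σ) * u) ≤
      (expAddFloorExp (u + h) - expAddFloorExp u) * Real.exp (-(2 * σ) * u) := fun u ↦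
    mul_le_mul_of_nonneg_right (sq_fractExp_sub_le (by linarith)) (Real.exp_pos _).le
  rw [← he, ofReal_integral_eq_lintegral_ofReal hd (Filter.Eventually.of_forall fun u ↦
    le_trans (by positivity) (hp u))]
  refine lintegral_mono fun u ↦ ?_
  rw [← ofReal_norm, ← ENNReal.ofReal_pow (norm_nonneg _)]
  refine ENNReal.ofReal_le_ofReal ((le_of_eq ?_).trans (hp u))
  rw [norm_mul, norm_real, mul_pow, Real.norm_eq_abs, sq_abs, norm_exp, ← Real.exp_nat_mul]
  congr 2
  simp
  ring

theorem half_le_norm_exp_sub_one {z : ℂ} (h0 : 0 ≤ z.re) (h1 : 1 ≤ z.im) (h2 : z.im ≤ 2) :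
    1 / 2 ≤ ‖cexp z - 1‖ := by
  have hs : 1 / 2 ≤ Real.sin z.im := by
    have hpi := Real.pi_gt_three
    have hpi' := Real.pi_lt_d2
    rcases le_or_gt z.im (Real.pi / 2) with h | h
    · refine le_trans ?_ (Real.mul_le_sin (by linarith) h)
      rw [div_mul_eq_mul_div, le_div_iff₀ Real.pi_pos]
      linarith
    · rw [← Real.sin_pi_sub]
      refine le_trans ?_ (Real.mul_le_sin (by linarith) (by linarith))
      rw [div_mul_eq_mul_div, le_div_iff₀ Real.pi_pos]
      linarith
  refine le_trans ?_ (abs_im_le_norm _)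
  rw [sub_im, one_im, sub_zero, exp_im]
  refine le_trans ?_ (le_abs_self _)
  have := Real.one_le_exp h0
  nlinarith

open MeasureTheory Set in
/-- A mean square bound for `ζ` on vertical lines to the right of the critical line. -/
theorem exists_setLIntegral_enorm_riemannZeta_sq_le {σ₀ : ℝ} (hσ₀ : 1 / 2 < σ₀) :
    ∃ C : ℝ, 0 < C ∧ ∀ T σ : ℝ, 1 ≤ T → σ₀ ≤ σ → σ ≤ 6 →
      ∫⁻ t in Icc T (2 * T), ‖riemannZeta (σ + t * I)‖ₑ ^ 2 ≤ ENNReal.ofReal (C * T) := by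
  set D := 24 * Real.exp 12 / (2 * σ₀ - 1) with hD
  have hD0 : 0 < D := div_pos (by positivity) (by linarith)
  refine ⟨8 + 512 * 20 * D, by positivity, fun T σ hT hσ hσ6 ↦ ?_⟩
  have hT0 : 0 < T := by linarith
  set h := 1 / T with hh
  have hh0 : 0 < h := by positivity
  have hh1 : h ≤ 1 := by rw [hh, div_le_one hT0]; exact hT
  set g : ℝ → ℂ := fun u ↦ ((fractExp (u + h) - fractExp u : ℝ) : ℂ) * cexp (-σ * u) with hg
  have hgm : Measurable g := by
    have := measurable_fractExp
    simp only [hg]; fun_prop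
  have hkey : ∀ t : ℝ, Integrable (fun u : ℝ ↦ cexp (-(t * u) * I) * g u) ∧
      ∫ u : ℝ, cexp (-(t * u) * I) * g u = (cexp ((σ + t * I) * h) - 1) *
        ∫ x in Ioi (1 : ℝ), ((Int.fract x : ℝ) : ℂ) * (x : ℂ) ^ (-((σ + t * I) + 1)) := by
    intro t
    have hre : 0 < (σ + t * I : ℂ).re := by simp; linarith
    obtain ⟨hi, he⟩ := integral_fract_mul_cpow_eq hre
    have := integral_sub_translate_mul (ψ := fun u ↦ (fractExp u : ℂ))
      (E := fun u : ℝ ↦ cexp (-(σ + t * I) * u)) (q := cexp ((σ + t * I) * h)) (h := h)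
      (fun u ↦ by rw [← Complex.exp_add]; congr 1; push_cast; ring) hi
    have e : (fun u : ℝ ↦ cexp (-(t * u) * I) * g u) = fun u : ℝ ↦
        ((fractExp (u + h) : ℂ) - fractExp u) * cexp (-(σ + t * I) * u) := by
      funext u
      simp only [hg]
      rw [show -(σ + t * I) * (u : ℂ) = -(t * u) * I + -σ * u by ring, Complex.exp_add]
      push_cast
      ring
    rw [e, he]
    exact this
  have hgi : Integrable g := by simpa using (hkey 0).1
  have hgsq : ∫⁻ u, ‖g u‖ₑ ^ 2 ≤ ENNReal.ofReal (D / T) := by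
    refine (lintegral_enorm_fractExp_sub_sq_le (by linarith) hh0.le).trans
      (ENNReal.ofReal_le_ofReal ?_)
    have h1 : Real.exp (2 * σ * h) - 1 ≤ 12 * h * Real.exp 12 := by
      have h2 : 2 * σ * h ≤ 12 * h := by nlinarith
      have h3 : 1 - 12 * h ≤ Real.exp (-(12 * h)) := by
        have := Real.add_one_le_exp (-(12 * h)); linarith
      have h4 : Real.exp (12 * h) * Real.exp (-(12 * h)) = 1 := by
        rw [← Real.exp_add]; simp
      have h5 : Real.exp (12 * h) ≤ Real.exp 12 := Real.exp_le_exp.mpr (by linarith)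
      have h6 := Real.exp_le_exp.mpr h2
      have h7 := Real.exp_pos (12 * h)
      nlinarith
    calc _ ≤ 12 * h * Real.exp 12 * (2 / (2 * σ₀ - 1)) := by
            refine mul_le_mul h1 ?_ (div_nonneg zero_le_two (by linarith)) (by positivity)
            exact div_le_div_of_nonneg_left zero_le_two (by linarith) (by linarith)
      _ = D / T := by rw [hD, hh]; field_simp; ring
  have hfour := setLIntegral_enorm_fourier_sq_le hgm hgi (T := 2 * T) (by linarith)
  have hpt : ∀ t ∈ Icc T (2 * T), ‖riemannZeta (σ + t * I)‖ₑ ^ 2 ≤ ENNReal.ofReal 8 +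
      ENNReal.ofReal (512 * T ^ 2) * ‖∫ u : ℝ, cexp (-(t * u) * I) * g u‖ₑ ^ 2 := by
    intro t ht
    set s : ℂ := σ + t * I with hs
    have hre : s.re = σ := by simp [hs]
    have him : s.im = t := by simp [hs]
    have ht0 : 1 ≤ t := hT.trans ht.1
    have hs1 : 1 ≤ ‖s - 1‖ := by
      refine le_trans ?_ (abs_im_le_norm _)
      rw [sub_im, him, one_im, sub_zero]
      exact ht0.trans (le_abs_self _)
    have hsne : s ≠ 1 := fun h ↦ by simp [h] at hs1; linarith
    have hsn : ‖s‖ ≤ 8 * T := by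
      refine (norm_le_abs_re_add_abs_im s).trans ?_
      rw [hre, him, abs_of_pos (by linarith), abs_of_pos (by linarith)]
      linarith [ht.2]
    have hq : ‖s / (s - 1)‖ ≤ 2 := by
      rw [norm_div, div_le_iff₀ (by linarith)]
      calc ‖s‖ = ‖(s - 1) + 1‖ := by simp
        _ ≤ ‖s - 1‖ + 1 := by simpa using norm_add_le (s - 1) 1
        _ ≤ _ := by linarith
    set F := ∫ x in Ioi (1 : ℝ), ((Int.fract x : ℝ) : ℂ) * (x : ℂ) ^ (-(s + 1)) with hF
    have hz : riemannZeta s = s / (s - 1) - s * F :=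
      riemannZeta_eq_sub_integral_fract (by linarith) hsne
    have he : 1 / 2 ≤ ‖cexp (s * h) - 1‖ := by
      have hhT : h * T = 1 := by rw [hh]; field_simp
      refine half_le_norm_exp_sub_one ?_ ?_ ?_
      · have : 0 ≤ σ * h := mul_nonneg (by linarith) hh0.le
        simpa [hre] using this
      · simp [him]; nlinarith [ht.1]
      · simp [him]; nlinarith [ht.2]
    have hFn : ‖F‖ ≤ 2 * ‖∫ u : ℝ, cexp (-(t * u) * I) * g u‖ := by
      rw [(hkey t).2, norm_mul]
      nlinarith [norm_nonneg F]
    set W := ‖∫ u : ℝ, cexp (-(t * u) * I) * g u‖ with hW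
    have hzn : ‖riemannZeta s‖ ≤ 2 + 16 * T * W := by
      rw [hz]
      refine (norm_sub_le _ _).trans (add_le_add hq ?_)
      rw [norm_mul]
      calc ‖s‖ * ‖F‖ ≤ (8 * T) * (2 * W) := by gcongr
        _ = _ := by ring
    rw [← ofReal_norm, ← ofReal_norm, ← ENNReal.ofReal_pow (norm_nonneg _),
      ← ENNReal.ofReal_pow (norm_nonneg _), ← ENNReal.ofReal_mul (by positivity),
      ← ENNReal.ofReal_add (by norm_num) (by positivity)]
    refine ENNReal.ofReal_le_ofReal ((pow_le_pow_left₀ (norm_nonneg _) hzn 2).trans ?_)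
    rw [← hW]
    nlinarith [sq_nonneg (2 - 16 * T * W)]
  calc _ ≤ ∫⁻ t in Icc T (2 * T), (ENNReal.ofReal 8 +
        ENNReal.ofReal (512 * T ^ 2) * ‖∫ u : ℝ, cexp (-(t * u) * I) * g u‖ₑ ^ 2) :=
        setLIntegral_mono' measurableSet_Icc hpt
    _ ≤ ENNReal.ofReal 8 * ENNReal.ofReal T + ENNReal.ofReal (512 * T ^ 2) *
        (ENNReal.ofReal 20 * ENNReal.ofReal (D / T)) := by
        rw [lintegral_add_left measurable_const, lintegral_const_mul' _ _ ENNReal.ofReal_ne_top,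
          setLIntegral_const, Real.volume_Icc, show 2 * T - T = T by ring]
        gcongr
        refine (lintegral_mono_set (Icc_subset_Icc_left (by linarith))).trans (hfour.trans ?_)
        gcongr
    _ = _ := by
        rw [← ENNReal.ofReal_mul (by norm_num), ← ENNReal.ofReal_mul (by norm_num),
          ← ENNReal.ofReal_mul (by positivity), ← ENNReal.ofReal_add (by positivity) (by positivity)]
        congr 1
        field_simp

open MeasureTheory Set Metric in
theorem enorm_le_lintegral_circleMap {f : ℂ → ℂ} {c w : ℂ} {r R : ℝ} (hR : 0 < R) (hrR : r < R)
    (hf : DiffContOnCl ℂ f (ball c R)) (hw : w ∈ closedBall c r) :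
    ‖f w‖ₑ ≤ ENNReal.ofReal (R / (2 * Real.pi * (R - r))) *
      ∫⁻ θ in Ioc 0 (2 * Real.pi), ‖f (circleMap c R θ)‖ₑ := by
  have hw' : w ∈ ball c R := closedBall_subset_ball hrR hw
  have h := hf.two_pi_i_inv_smul_circleIntegral_sub_inv_smul hw'
  rw [← h, enorm_smul, circleIntegral, intervalIntegral.integral_of_le Real.two_pi_pos.le]
  have e : ‖(2 * Real.pi * I : ℂ)⁻¹‖ₑ = ENNReal.ofReal (2 * Real.pi)⁻¹ := by
    rw [← ofReal_norm]
    congr 1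
    simp [abs_of_pos Real.pi_pos]
  rw [e, show R / (2 * Real.pi * (R - r)) = (2 * Real.pi)⁻¹ * (R / (R - r)) by
    have : R - r ≠ 0 := by linarith
    field_simp, ENNReal.ofReal_mul (by positivity), mul_assoc]
  gcongr
  refine (enorm_integral_le_lintegral_enorm _).trans ?_
  rw [← lintegral_const_mul' _ _ ENNReal.ofReal_ne_top]
  refine lintegral_mono fun θ ↦ ?_
  rw [enorm_smul, enorm_smul, ← mul_assoc]
  gcongr
  rw [← ofReal_norm, ← ofReal_norm, ← ENNReal.ofReal_mul (norm_nonneg _)]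
  refine ENNReal.ofReal_le_ofReal ?_
  rw [deriv_circleMap, norm_mul, norm_I, mul_one, norm_circleMap_zero, abs_of_pos hR, norm_inv,
    ← div_eq_mul_inv]
  have h1 : R - r ≤ ‖circleMap c R θ - w‖ := by
    have h2 : ‖circleMap c R θ - c‖ = R := by
      simp [abs_of_pos hR]
    have h3 : ‖w - c‖ ≤ r := by simpa [dist_eq_norm] using hw
    have h4 : circleMap c R θ - w = (circleMap c R θ - c) - (w - c) := by ring
    rw [h4]
    linarith [norm_sub_norm_le (circleMap c R θ - c) (w - c)]
  exact div_le_div_of_nonneg_left hR.le (by linarith) h1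

open MeasureTheory Set Metric in
theorem exists_card_zeros_le_lintegral {r R R' : ℝ} (hr : 0 < r) (hrR : r < R) (hR : R < R')
    (hR' : R' < 3) : ∃ C : ℝ, 0 < C ∧ ∀ t : ℝ, 4 ≤ t → ∀ S : Finset ℂ,
      (∀ z ∈ S, z ∈ closedBall (3 + t * I : ℂ) r ∧ riemannZeta z = 0) →
      (S.card : ENNReal) ≤ ENNReal.ofReal C * (1 + ∫⁻ θ in Ioc 0 (2 * Real.pi),
        ‖riemannZeta (circleMap (3 + t * I) R' θ)‖ₑ ^ 2) := by
  set A := R' / (2 * Real.pi * (R' - R)) with hA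
  have hA0 : 0 < A := div_pos (by linarith) (mul_pos Real.two_pi_pos (by linarith))
  have hL : 0 < Real.log (R / r) := Real.log_pos ((one_lt_div hr).mpr hrR)
  refine ⟨3 * (1 + A) / Real.log (R / r), by positivity, fun t ht S hS ↦ ?_⟩
  set c : ℂ := 3 + t * I with hc
  set Q := ∫⁻ θ in Ioc 0 (2 * Real.pi), ‖riemannZeta (circleMap c R' θ)‖ₑ ^ 2 with hQ
  have hne : ∀ z ∈ closedBall c R', z ≠ 1 := by
    rintro z hz rfl
    rw [mem_closedBall, dist_eq_norm] at hz
    have := (abs_im_le_norm _).trans hz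
    simp [hc] at this
    rw [abs_of_pos (by linarith)] at this
    linarith
  have hd : ∀ z ∈ closedBall c R', DifferentiableAt ℂ riemannZeta z := fun z hz ↦
    differentiableAt_riemannZeta (hne z hz)
  have han : AnalyticOnNhd ℂ riemannZeta (closedBall c R) := by
    have : AnalyticOnNhd ℂ riemannZeta {z | z ≠ 1} :=
      DifferentiableOn.analyticOnNhd (fun z hz ↦ (differentiableAt_riemannZeta hz).differentiableWithinAt)
        isOpen_ne
    exact this.mono fun z hz ↦ hne z (closedBall_subset_closedBall hR.le hz)
  rcases eq_or_ne Q ⊤ with hQt | hQt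
  · rw [hQt, add_top, ENNReal.mul_top]
    · exact le_top
    · simp; positivity
  set q := Q.toReal with hq
  have hq0 : 0 ≤ q := ENNReal.toReal_nonneg
  have hζc : 7 / 20 ≤ ‖riemannZeta c‖ := by
    have h1 := norm_riemannZeta_sub_one_le (s := c) (by simp [hc]; norm_num)
    have h2 := norm_sub_norm_le (1 : ℂ) (1 - riemannZeta c)
    rw [norm_one, sub_sub_cancel, norm_sub_rev] at h2
    linarith
  have hb : ∀ z ∈ sphere c R, ‖riemannZeta z‖ ≤ 1 + A * q := by
    intro z hz
    have hcl : DiffContOnCl ℂ (fun z ↦ riemannZeta z ^ 2) (ball c R') := by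
      refine DifferentiableOn.diffContOnCl fun z hz ↦ ?_
      exact ((hd z (closure_ball_subset_closedBall hz)).pow 2).differentiableWithinAt
    have h1 := enorm_le_lintegral_circleMap (by linarith) hR hcl (sphere_subset_closedBall hz)
    simp only [enorm_pow] at h1
    rw [← hQ, ← hA, ← ENNReal.ofReal_toReal hQt, ← ofReal_norm, ← ENNReal.ofReal_pow (norm_nonneg _),
      ← ENNReal.ofReal_mul hA0.le, ENNReal.ofReal_le_ofReal_iff (by positivity)] at h1
    nlinarith [sq_nonneg (‖riemannZeta z‖ - 1)]
  have hcard := Complex.card_zeros_le_of_norm_le hr hrR (M := 1 + A * q)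
    (by nlinarith [mul_nonneg hA0.le hq0]) han
    (norm_pos_iff.mp (by linarith)) hb S hS
  have h2 : (S.card : ℝ) ≤ 3 * (1 + A) / Real.log (R / r) * (1 + q) := by
    refine hcard.trans ?_
    rw [div_mul_eq_mul_div (3 * (1 + A))]
    refine div_le_div_of_nonneg_right ?_ hL.le
    have hpos : 0 < (1 + A * q) / ‖riemannZeta c‖ := by
      have : 0 < ‖riemannZeta c‖ := by linarith
      positivity
    refine (Real.log_le_self hpos.le).trans ?_
    rw [div_le_iff₀ (by linarith)]
    have : 1 + A * q ≤ (1 + A) * (1 + q) := by nlinarith [mul_nonneg hA0.le hq0]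
    have : 0 ≤ (1 + A) * (1 + q) := by positivity
    nlinarith
  rw [← ENNReal.ofReal_toReal hQt, ← hq, ← ENNReal.ofReal_one, ← ENNReal.ofReal_add zero_le_one hq0,
    ← ENNReal.ofReal_mul (by positivity), ← ENNReal.ofReal_natCast]
  exact ENNReal.ofReal_le_ofReal h2

open MeasureTheory Set in
theorem exists_lintegral_riemannZeta_sq_circleMap_le {R : ℝ} (hR0 : 0 < R) (hR : R < 5 / 2) :
    ∃ C : ℝ, 0 < C ∧ ∀ X : ℝ, 8 ≤ X →
      ∫⁻ t in Icc (X - 1) (2 * X + 1), ∫⁻ θ in Ioc 0 (2 * Real.pi),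
        ‖riemannZeta (circleMap (3 + t * I) R θ)‖ₑ ^ 2 ≤ ENNReal.ofReal (C * X) := by
  obtain ⟨C, hC, h⟩ := exists_setLIntegral_enorm_riemannZeta_sq_le (σ₀ := 3 - R) (by linarith)
  refine ⟨2 * Real.pi * (4 * C), by positivity, fun X hX ↦ ?_⟩
  have hmeas : Measurable fun p : ℝ × ℝ ↦
      ‖riemannZeta (circleMap (3 + p.1 * I) R p.2)‖ₑ ^ 2 := by
    have hz : Measurable riemannZeta := measurable_of_continuousOn_compl_singleton 1 fun z hz ↦
      (differentiableAt_riemannZeta hz).continuousAt.continuousWithinAt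
    unfold circleMap
    fun_prop
  rw [lintegral_lintegral_swap hmeas.aemeasurable]
  have hone : ∀ θ : ℝ, ∫⁻ t in Icc (X - 1) (2 * X + 1),
      ‖riemannZeta (circleMap (3 + t * I) R θ)‖ₑ ^ 2 ≤ ENNReal.ofReal (4 * C * X) := by
    intro θ
    set σ := 3 + R * Real.cos θ with hσ
    set y := R * Real.sin θ with hy
    have hc1 := Real.neg_one_le_cos θ
    have hc2 := Real.cos_le_one θ
    have hs1 := Real.neg_one_le_sin θ
    have hs2 := Real.sin_le_one θ
    have e : ∀ t : ℝ, circleMap (3 + t * I) R θ = σ + ((t + y : ℝ) : ℂ) * I := by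
      intro t
      rw [circleMap, exp_mul_I, hσ, hy]
      push_cast
      ring
    simp_rw [e]
    have hg : ∫⁻ t in Icc (X - 1) (2 * X + 1), ‖riemannZeta (σ + ((t + y : ℝ) : ℂ) * I)‖ₑ ^ 2 ≤
        ∫⁻ t in Icc (X / 2) (4 * X), ‖riemannZeta (σ + t * I)‖ₑ ^ 2 := by
      rw [← lintegral_indicator measurableSet_Icc, ← lintegral_indicator measurableSet_Icc,
        ← lintegral_add_right_eq_self ((Icc (X / 2) (4 * X)).indicator _) y]
      refine lintegral_mono fun t ↦ ?_
      by_cases ht : t ∈ Icc (X - 1) (2 * X + 1)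
      · have ht' : t + y ∈ Icc (X / 2) (4 * X) := by
          constructor <;> nlinarith [ht.1, ht.2]
        rw [indicator_of_mem ht, indicator_of_mem ht']
      · rw [indicator_of_notMem ht]
        exact zero_le
    refine hg.trans ?_
    have hsub : Icc (X / 2) (4 * X) ⊆
        (Icc (X / 2) (2 * (X / 2)) ∪ Icc X (2 * X)) ∪ Icc (2 * X) (2 * (2 * X)) := by
      intro t ht
      rcases le_or_gt t X with h1 | h1
      · exact Or.inl (Or.inl ⟨ht.1, by linarith⟩)
      · rcases le_or_gt t (2 * X) with h2 | h2
        · exact Or.inl (Or.inr ⟨h1.le, h2⟩)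
        · exact Or.inr ⟨h2.le, by linarith [ht.2]⟩
    refine (lintegral_mono_set hsub).trans ((lintegral_union_le _ _ _).trans
      ((add_le_add (lintegral_union_le _ _ _) le_rfl).trans ?_))
    have hσ1 : 3 - R ≤ σ := by nlinarith
    have hσ2 : σ ≤ 6 := by nlinarith
    refine (add_le_add (add_le_add (h _ σ (by linarith) hσ1 hσ2) (h _ σ (by linarith) hσ1 hσ2))
      (h _ σ (by linarith) hσ1 hσ2)).trans ?_
    rw [← ENNReal.ofReal_add (by positivity) (by positivity),
      ← ENNReal.ofReal_add (by positivity) (by positivity)]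
    refine ENNReal.ofReal_le_ofReal ?_
    nlinarith
  refine (lintegral_mono hone).trans (le_of_eq ?_)
  rw [setLIntegral_const, Real.volume_Ioc, ← ENNReal.ofReal_mul (by positivity)]
  congr 1
  ring

open MeasureTheory Set Metric in
/-- To the right of a fixed line `re s = σ > 1/2` the zeta function has `O(X)` zeros with
imaginary part in `[X, 2X]`. -/
theorem exists_card_riemannZeta_zeros_le {σ : ℝ} (hσ : 1 / 2 < σ) :
    ∃ C : ℝ, 0 < C ∧ ∀ X : ℝ, 8 ≤ X → ∀ S : Finset ℂ,
      (∀ z ∈ S, riemannZeta z = 0 ∧ σ ≤ z.re ∧ X ≤ z.im ∧ z.im ≤ 2 * X) →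
      (S.card : ℝ) ≤ C * X := by
  set δ := min (σ - 1 / 2) (1 / 2) with hδ
  have hδ0 : 0 < δ := lt_min (by linarith) (by norm_num)
  have hδ1 : δ ≤ σ - 1 / 2 := min_le_left _ _
  have hδ2 : δ ≤ 1 / 2 := min_le_right _ _
  obtain ⟨C₁, hC₁, h₁⟩ := exists_card_zeros_le_lintegral (r := 5 / 2 - 3 * δ / 4)
    (R := 5 / 2 - δ / 2) (R' := 5 / 2 - δ / 4) (by linarith) (by linarith) (by linarith)
    (by linarith)
  obtain ⟨C₂, hC₂, h₂⟩ := exists_lintegral_riemannZeta_sq_circleMap_le (R := 5 / 2 - δ / 4)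
    (by linarith) (by linarith)
  refine ⟨C₁ * (2 + C₂) / (2 * δ), by positivity, fun X hX S hS ↦ ?_⟩
  have hleft : ∫⁻ t in Icc (X - 1) (2 * X + 1),
      ∑ z ∈ S, (Icc (z.im - δ) (z.im + δ)).indicator 1 t = S.card * ENNReal.ofReal (2 * δ) := by
    rw [lintegral_finsetSum _ fun z _ ↦ measurable_one.indicator measurableSet_Icc]
    rw [Finset.sum_congr rfl (g := fun _ ↦ ENNReal.ofReal (2 * δ)), Finset.sum_const, nsmul_eq_mul]
    intro z hz
    obtain ⟨-, -, h3, h4⟩ := hS z hz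
    rw [lintegral_indicator_one measurableSet_Icc, Measure.restrict_apply measurableSet_Icc,
      inter_eq_left.mpr (Icc_subset_Icc (by linarith) (by linarith)), Real.volume_Icc]
    congr 1
    ring
  have hpt : ∀ t ∈ Icc (X - 1) (2 * X + 1),
      ∑ z ∈ S, (Icc (z.im - δ) (z.im + δ)).indicator (1 : ℝ → ENNReal) t ≤
        ENNReal.ofReal C₁ * (1 + ∫⁻ θ in Ioc 0 (2 * Real.pi),
        ‖riemannZeta (circleMap (3 + t * I) (5 / 2 - δ / 4) θ)‖ₑ ^ 2) := by
    intro t ht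
    classical
    have e : ∑ z ∈ S, (Icc (z.im - δ) (z.im + δ)).indicator (1 : ℝ → ENNReal) t =
        ((S.filter fun z ↦ t ∈ Icc (z.im - δ) (z.im + δ)).card : ENNReal) := by
      simp only [indicator_apply, Pi.one_apply]
      rw [Finset.sum_boole]
    rw [e]
    refine h₁ t (by linarith [ht.1]) _ fun z hz ↦ ?_
    obtain ⟨hz1, hz2⟩ := Finset.mem_filter.mp hz
    obtain ⟨h0, h3, h4, h5⟩ := hS z hz1
    refine ⟨?_, h0⟩
    have hz3 := re_mem_Ioo_of_riemannZeta_eq_zero h0 (by linarith)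
    rw [mem_closedBall, dist_eq_norm, ← abs_of_pos (show 0 < 5 / 2 - 3 * δ / 4 by linarith),
      ← sq_le_sq₀ (norm_nonneg _) (abs_nonneg _), sq_abs, ← normSq_eq_norm_sq, normSq_apply]
    simp only [sub_re, add_re, mul_re, ofReal_re, I_re, mul_zero, ofReal_im, I_im, mul_one, sub_self,
      add_zero, sub_im, add_im, mul_im, zero_add, re_ofNat, im_ofNat]
    have h6 : (z.im - t) ^ 2 ≤ δ ^ 2 := sq_le_sq' (by linarith [hz2.2]) (by linarith [hz2.1])
    have h7 : (z.re - 3) ^ 2 ≤ (5 / 2 - δ) ^ 2 := by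
      rw [← neg_sq (z.re - 3)]
      exact pow_le_pow_left₀ (by linarith) (by linarith) 2
    nlinarith
  have hfin : (S.card : ENNReal) * ENNReal.ofReal (2 * δ) ≤
      ENNReal.ofReal (C₁ * ((2 + C₂) * X)) := by
    rw [← hleft]
    refine (setLIntegral_mono' measurableSet_Icc hpt).trans ?_
    rw [lintegral_const_mul' _ _ ENNReal.ofReal_ne_top, lintegral_add_left measurable_const,
      setLIntegral_const, Real.volume_Icc, one_mul, ENNReal.ofReal_mul hC₁.le]
    gcongr
    refine (add_le_add le_rfl (h₂ X hX)).trans ?_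
    rw [← ENNReal.ofReal_add (by linarith) (by positivity)]
    exact ENNReal.ofReal_le_ofReal (by linarith)
  rw [← ENNReal.ofReal_natCast, ← ENNReal.ofReal_mul (by positivity),
    ENNReal.ofReal_le_ofReal_iff (by positivity)] at hfin
  rw [div_mul_eq_mul_div, le_div_iff₀ (by positivity)]
  linarith

theorem summable_abs_mul_pow_of_le_rpow {η : ℕ → ℝ} {A B : ℝ} {m : ℕ} (hm : 1 ≤ m) (hA : 0 < A)
    (hη : ∀ j, m ≤ j → |η j| ≤ (A * (j : ℝ)) ^ B) {q : ℝ} (hq0 : 0 < q) (hq1 : q < 1) :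
    Summable fun j : ℕ ↦ |η (j + m)| * q ^ j := by
  have h1 := summable_pow_mul_geometric_of_norm_lt_one ⌈B⌉₊ (r := q)
    (by rwa [Real.norm_of_nonneg hq0.le])
  have h2 := ((summable_nat_add_iff m).mpr h1).mul_left (A ^ B * (q ^ m)⁻¹)
  refine h2.of_nonneg_of_le (fun j ↦ by positivity) fun j ↦ ?_
  have hj : (1 : ℝ) ≤ ((j + m : ℕ) : ℝ) := by exact_mod_cast hm.trans (Nat.le_add_left m j)
  have h3 : |η (j + m)| ≤ A ^ B * ((j + m : ℕ) : ℝ) ^ ⌈B⌉₊ := by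
    refine (hη _ (Nat.le_add_left m j)).trans ?_
    rw [Real.mul_rpow hA.le (by linarith)]
    refine mul_le_mul_of_nonneg_left ?_ (by positivity)
    rw [← Real.rpow_natCast]
    exact Real.rpow_le_rpow_of_exponent_le hj (Nat.le_ceil B)
  calc |η (j + m)| * q ^ j ≤ A ^ B * ((j + m : ℕ) : ℝ) ^ ⌈B⌉₊ * q ^ j := by gcongr
    _ = _ := by rw [pow_add]; field_simp

theorem norm_tsum_mul_pow_le {η : ℕ → ℝ} {m : ℕ} {q : ℝ}
    (hs : Summable fun j : ℕ ↦ |η (j + m)| * q ^ j) {x : ℂ} (hx : ‖x‖ ≤ q) :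
    ‖∑' j : ℕ, (η (j + m) : ℂ) * x ^ (j + m)‖ ≤ (∑' j : ℕ, |η (j + m)| * q ^ j) * ‖x‖ ^ m := by
  refine tsum_of_norm_bounded (hs.hasSum.mul_right _) fun j ↦ ?_
  rw [norm_mul, norm_real, Real.norm_eq_abs, norm_pow, pow_add, ← mul_assoc]
  gcongr

theorem analyticOnNhd_tsum_mul_pow {η : ℕ → ℝ} {m : ℕ}
    (hs : ∀ q : ℝ, 0 < q → q < 1 → Summable fun j : ℕ ↦ |η (j + m)| * q ^ j) :
    AnalyticOnNhd ℂ (fun x : ℂ ↦ 1 + ∑' j : ℕ, (η (j + m) : ℂ) * x ^ (j + m))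
      (Metric.ball 0 1) := by
  intro x hx
  have hx1 : ‖x‖ < 1 := by simpa using hx
  obtain ⟨q, hq, hq1⟩ := exists_between hx1
  have hq0 : 0 < q := (norm_nonneg x).trans_lt hq
  have hd : DifferentiableOn ℂ (fun x : ℂ ↦ ∑' j : ℕ, (η (j + m) : ℂ) * x ^ (j + m))
      (Metric.ball 0 q) := by
    refine differentiableOn_tsum_of_summable_norm (hs q hq0 hq1) (fun j ↦ by fun_prop)
      Metric.isOpen_ball fun j w hw ↦ ?_
    have hw' : ‖w‖ < q := by simpa using hw
    rw [norm_mul, norm_real, Real.norm_eq_abs, norm_pow]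
    gcongr
    rw [pow_add]
    calc ‖w‖ ^ j * ‖w‖ ^ m ≤ q ^ j * 1 := by
          gcongr
          exact pow_le_one₀ (norm_nonneg _) (hw'.trans hq1).le
      _ = _ := mul_one _
  exact analyticAt_const.add (hd.analyticAt (Metric.isOpen_ball.mem_nhds (by simpa using hq)))

theorem finite_zeros_one_add_tsum_mul_pow {η : ℕ → ℝ} {m : ℕ} (hm : 1 ≤ m)
    (hs : ∀ q : ℝ, 0 < q → q < 1 → Summable fun j : ℕ ↦ |η (j + m)| * q ^ j)
    {q : ℝ} (hq0 : 0 < q) (hq1 : q < 1) :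
    {x : ℂ | ‖x‖ ≤ q ∧ 1 + ∑' j : ℕ, (η (j + m) : ℂ) * x ^ (j + m) = 0}.Finite := by
  obtain ⟨q', hqq, hq'⟩ := exists_between hq1
  have hq'0 := hq0.trans hqq
  set K := ∑' j : ℕ, |η (j + m)| * q' ^ j with hK
  have hK0 : 0 ≤ K := tsum_nonneg fun j ↦ by positivity
  by_contra hinf
  set g : ℂ → ℂ := fun x ↦ 1 + ∑' j : ℕ, (η (j + m) : ℂ) * x ^ (j + m) with hg
  have hg0 : g 0 = 1 := by
    have : ∀ j, (0 : ℂ) ^ (j + m) = 0 := fun j ↦ zero_pow (by omega)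
    simp [hg, this]
  obtain ⟨n, hn⟩ := exists_nat_gt (Real.log ((1 + K) / ‖g 0‖) / Real.log (q' / q))
  obtain ⟨S, hS, hSn⟩ := Set.Infinite.exists_subset_card_eq hinf n
  have := Complex.card_zeros_le_of_norm_le (c := 0) hq0 hqq (M := 1 + K) (by linarith)
    ((analyticOnNhd_tsum_mul_pow hs).mono (Metric.closedBall_subset_ball hq'))
    (by change g 0 ≠ 0; simp [hg0]) (fun z hz ↦ ?_) S fun z hz ↦ ?_
  · rw [hSn] at this
    exact absurd (this.trans_lt hn) (lt_irrefl _)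
  · have hz' : ‖z‖ = q' := by simpa using hz
    have h1 := norm_tsum_mul_pow_le (hs q' hq'0 hq') hz'.le
    refine (norm_add_le _ _).trans ?_
    rw [norm_one]
    have h2 : ‖z‖ ^ m ≤ 1 := pow_le_one₀ (norm_nonneg _) (by rw [hz']; exact hq'.le)
    nlinarith
  · obtain ⟨h1, h2⟩ := hS (Finset.mem_coe.mpr hz)
    exact ⟨by simpa using h1, h2⟩

/-- The points of the half-plane `re ρ ≥ 1 / 2` at which the Euler product in `ρ / ℓ` vanishes are
parametrised by finitely many primes `p` and values of `p ^ (-ρ / ℓ)`. -/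
theorem exists_finset_of_tprod_eq_zero {η : ℕ → ℝ} {A B : ℝ} {ℓ : ℕ} (hℓ : 1 ≤ ℓ) (hA : 0 < A)
    (hη : ∀ j : ℕ, 2 * ℓ + 1 ≤ j → |η j| ≤ (A * (j : ℝ)) ^ B) :
    ∃ P : Finset Nat.Primes, ∃ Z : Finset ℂ, ∀ ρ : ℂ, 1 / 2 ≤ ρ.re →
      (∏' p : Nat.Primes, (1 + ∑' j : ℕ, (η (j + (2 * ℓ + 1)) : ℂ) *
          ((p : ℕ) : ℂ) ^ (-(((j + (2 * ℓ + 1) : ℕ) : ℂ)) * (ρ / (ℓ : ℂ))))) = 0 →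
      ∃ p ∈ P, ((p : ℕ) : ℂ) ^ (-(ρ / ℓ)) ∈ Z := by
  set m := 2 * ℓ + 1 with hm
  have hℓ0 : (0 : ℝ) < ℓ := by exact_mod_cast hℓ
  have hs : ∀ q : ℝ, 0 < q → q < 1 → Summable fun j : ℕ ↦ |η (j + m)| * q ^ j := fun q h0 h1 ↦
    summable_abs_mul_pow_of_le_rpow (by omega) hA hη h0 h1
  set q : ℝ := 2 ^ (-(1 / (2 * ℓ) : ℝ)) with hq
  have hq0 : 0 < q := by positivity
  have hq1 : q < 1 := Real.rpow_lt_one_of_one_lt_of_neg one_lt_two (by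
    have : 0 < 1 / (2 * (ℓ : ℝ)) := by positivity
    linarith)
  set K := ∑' j : ℕ, |η (j + m)| * q ^ j with hK
  have hK0 : 0 ≤ K := tsum_nonneg fun j ↦ by positivity
  have hsum : Summable fun p : Nat.Primes ↦ K * ((p : ℕ) : ℝ) ^ (-(m / (2 * ℓ) : ℝ)) := by
    refine (Nat.Primes.summable_rpow.mpr ?_).mul_left K
    rw [neg_lt_neg_iff, lt_div_iff₀ (by positivity), hm]
    push_cast
    linarith
  have hfin : {p : Nat.Primes | ¬ K * ((p : ℕ) : ℝ) ^ (-(m / (2 * ℓ) : ℝ)) < 1}.Finite :=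
    Filter.eventually_cofinite.mp
      (hsum.tendsto_cofinite_zero.eventually_lt_const zero_lt_one)
  refine ⟨hfin.toFinset, (finite_zeros_one_add_tsum_mul_pow (by omega) hs hq0 hq1).toFinset,
    fun ρ hρ h0 ↦ ?_⟩
  have hp0 : ∀ p : Nat.Primes, ((p : ℕ) : ℂ) ≠ 0 := fun p ↦ by exact_mod_cast p.2.ne_zero
  have hpow : ∀ (p : Nat.Primes) (j : ℕ), ((p : ℕ) : ℂ) ^ (-(((j + m : ℕ) : ℂ)) * (ρ / (ℓ : ℂ))) =
      (((p : ℕ) : ℂ) ^ (-(ρ / ℓ))) ^ (j + m) := by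
    intro p j
    rw [← cpow_nat_mul]
    congr 1
    ring
  simp_rw [hpow] at h0
  have hre : 1 / (2 * ℓ) ≤ (ρ / ℓ).re := by
    rw [div_natCast_re, div_le_div_iff₀ (by positivity) hℓ0]
    nlinarith
  have hnorm : ∀ p : Nat.Primes, ‖((p : ℕ) : ℂ) ^ (-(ρ / ℓ))‖ ≤
      ((p : ℕ) : ℝ) ^ (-(1 / (2 * ℓ) : ℝ)) := by
    intro p
    rw [norm_natCast_cpow_of_pos p.2.pos, neg_re]
    exact Real.rpow_le_rpow_of_exponent_le (by exact_mod_cast p.2.one_le) (by linarith)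
  have hnorm2 : ∀ p : Nat.Primes, ‖((p : ℕ) : ℂ) ^ (-(ρ / ℓ))‖ ≤ q := by
    intro p
    refine (hnorm p).trans ?_
    have h2 : (2 : ℝ) ≤ (p : ℕ) := by exact_mod_cast p.2.two_le
    exact Real.rpow_le_rpow_of_nonpos zero_lt_two h2 (by
      have : 0 < 1 / (2 * (ℓ : ℝ)) := by positivity
      linarith)
  have hterm : ∀ p : Nat.Primes, ‖∑' j : ℕ, (η (j + m) : ℂ) *
      (((p : ℕ) : ℂ) ^ (-(ρ / ℓ))) ^ (j + m)‖ ≤ K * ((p : ℕ) : ℝ) ^ (-(m / (2 * ℓ) : ℝ)) := by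
    intro p
    refine (norm_tsum_mul_pow_le (hs q hq0 hq1) (hnorm2 p)).trans ?_
    refine mul_le_mul_of_nonneg_left ?_ hK0
    refine (pow_le_pow_left₀ (norm_nonneg _) (hnorm p) m).trans (le_of_eq ?_)
    rw [← Real.rpow_natCast, ← Real.rpow_mul (by positivity)]
    congr 1
    ring
  by_contra hcon
  refine tprod_one_add_ne_zero_of_summable (fun p hp ↦ ?_)
    (hsum.of_nonneg_of_le (fun p ↦ norm_nonneg _) hterm) h0
  have hpP : p ∈ hfin.toFinset := by
    rw [Set.Finite.mem_toFinset, Set.mem_ofPred_eq, not_lt]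
    refine le_trans ?_ (hterm p)
    rw [← neg_eq_of_add_eq_zero_right hp, norm_neg, norm_one]
  refine hcon ⟨p, hpP, ?_⟩
  rw [Set.Finite.mem_toFinset]
  exact ⟨hnorm2 p, hp⟩

theorem exists_card_zeros_tprod_le {η : ℕ → ℝ} {A B : ℝ} {ℓ : ℕ} (hℓ : 1 ≤ ℓ) (hA : 0 < A)
    (hη : ∀ j : ℕ, 2 * ℓ + 1 ≤ j → |η j| ≤ (A * (j : ℝ)) ^ B) :
    ∃ C : ℝ, 0 < C ∧ ∀ X : ℝ, 1 ≤ X → ∀ S : Finset ℂ,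
      (∀ ρ ∈ S, (1 / 2 ≤ ρ.re ∧ X ≤ ρ.im ∧ ρ.im ≤ 2 * X) ∧
      (∏' p : Nat.Primes, (1 + ∑' j : ℕ, (η (j + (2 * ℓ + 1)) : ℂ) *
          ((p : ℕ) : ℂ) ^ (-(((j + (2 * ℓ + 1) : ℕ) : ℂ)) * (ρ / (ℓ : ℂ))))) = 0) →
      (S.card : ℝ) ≤ C * X := by
  classical
  obtain ⟨P, Z, h⟩ := exists_finset_of_tprod_eq_zero hℓ hA hη
  have hℓ0 : (1 : ℝ) ≤ ℓ := by exact_mod_cast hℓ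
  obtain ⟨N, hN⟩ : ∃ N : ℕ, ∀ p ∈ P, (p : ℕ) ≤ N :=
    ⟨P.sup fun p ↦ (p : ℕ), fun p hp ↦ Finset.le_sup (f := fun p : Nat.Primes ↦ (p : ℕ)) hp⟩
  set D : ℝ := N + 1 with hD
  have hD0 : 0 < D := by positivity
  refine ⟨P.card * Z.card * (D + 2) + 1, by positivity, fun X hX S hS ↦ ?_⟩
  choose! p hpP hpZ using fun ρ (hρ : ρ ∈ S) ↦ h ρ (hS ρ hρ).1.1 (hS ρ hρ).2
  set F : ℂ → Nat.Primes × ℂ × ℤ := fun ρ ↦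
    (p ρ, ((p ρ : ℕ) : ℂ) ^ (-(ρ / ℓ)), ⌊ρ.im * D⌋) with hF
  have hmaps : Set.MapsTo F S ((P ×ˢ Z ×ˢ Finset.Icc ⌊X * D⌋ ⌊2 * X * D⌋ :
      Finset (Nat.Primes × ℂ × ℤ)) : Set (Nat.Primes × ℂ × ℤ)) := by
    intro ρ hρ
    obtain ⟨⟨-, h1, h2⟩, -⟩ := hS ρ hρ
    simp only [hF, Finset.coe_product, Set.mem_prod, Finset.mem_coe, Finset.mem_Icc]
    exact ⟨hpP ρ hρ, hpZ ρ hρ, Int.floor_mono (by gcongr), Int.floor_mono (by gcongr)⟩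
  have hinj : Set.InjOn F S := by
    intro ρ hρ ρ' hρ' heq
    simp only [hF, Prod.mk.injEq] at heq
    obtain ⟨e1, e2, e3⟩ := heq
    rw [← e1] at e2
    set r := p ρ with hr
    have hr2 : (2 : ℝ) ≤ (r : ℕ) := by exact_mod_cast r.2.two_le
    have hr0 : ((r : ℕ) : ℂ) ≠ 0 := by exact_mod_cast r.2.ne_zero
    have hlog : 0 < Real.log (r : ℕ) := Real.log_pos (by linarith)
    have hlogD : Real.log (r : ℕ) ≤ D := by
      have h1 := Real.log_le_self (show (0 : ℝ) ≤ (r : ℕ) by linarith)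
      have h2 : ((r : ℕ) : ℝ) ≤ N := by exact_mod_cast hN r (hpP ρ hρ)
      linarith
    rw [cpow_def_of_ne_zero hr0, cpow_def_of_ne_zero hr0, exp_eq_exp_iff_exists_int] at e2
    obtain ⟨n, hn⟩ := e2
    rw [(natCast_log (n := (r : ℕ))).symm] at hn
    have hℓc : (ℓ : ℂ) ≠ 0 := by exact_mod_cast (by omega : ℓ ≠ 0)
    have hn' : (Real.log (r : ℕ) : ℂ) * (ρ' - ρ) = (n * (2 * Real.pi * ℓ) : ℝ) * I := by
      field_simp at hn
      simp only [ofReal_mul, ofReal_intCast, ofReal_natCast, ofReal_ofNat]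
      linear_combination hn
    have hre : Real.log (r : ℕ) * (ρ'.re - ρ.re) = 0 := by
      have := congrArg re hn'
      rwa [re_ofReal_mul, re_ofReal_mul, I_re, mul_zero, sub_re] at this
    have him : Real.log (r : ℕ) * (ρ'.im - ρ.im) = n * (2 * Real.pi * ℓ) := by
      have := congrArg im hn'
      rwa [im_ofReal_mul, im_ofReal_mul, I_im, mul_one, sub_im] at this
    have habs : |ρ.im * D - ρ'.im * D| < 1 := Int.abs_sub_lt_one_of_floor_eq_floor e3
    have hn0 : n = 0 := by
      by_contra hne
      have h1 : (1 : ℝ) ≤ |(n : ℝ)| := by exact_mod_cast Int.one_le_abs hne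
      rw [← sub_mul, abs_mul, abs_of_pos hD0, abs_sub_comm] at habs
      have h2 := congrArg abs him
      rw [abs_mul, abs_mul (n : ℝ), abs_of_pos hlog, abs_of_pos (a := 2 * Real.pi * ℓ) (by positivity)]
        at h2
      have h3 : 1 ≤ 2 * Real.pi * ℓ := by nlinarith [Real.pi_gt_three]
      nlinarith [mul_le_mul_of_nonneg_right hlogD (abs_nonneg (ρ'.im - ρ.im)),
        mul_le_mul_of_nonneg_right h1 (zero_le_one.trans h3)]
    rw [hn0, Int.cast_zero, zero_mul] at him
    refine Complex.ext ?_ ?_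
    · have := (mul_eq_zero.mp hre).resolve_left hlog.ne'; linarith
    · have := (mul_eq_zero.mp him).resolve_left hlog.ne'; linarith
  have hcard := Finset.card_le_card_of_injOn F hmaps hinj
  rw [Finset.card_product, Finset.card_product, Int.card_Icc] at hcard
  have hI : (((⌊2 * X * D⌋ + 1 - ⌊X * D⌋).toNat : ℕ) : ℝ) ≤ (D + 2) * X := by
    have h1 : (((⌊2 * X * D⌋ + 1 - ⌊X * D⌋).toNat : ℤ) : ℝ) = ⌊2 * X * D⌋ + 1 - ⌊X * D⌋ := by
      rw [Int.toNat_of_nonneg]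
      · push_cast; ring
      · have : ⌊X * D⌋ ≤ ⌊2 * X * D⌋ := Int.floor_mono (by nlinarith)
        omega
    have h2 : (((⌊2 * X * D⌋ + 1 - ⌊X * D⌋).toNat : ℕ) : ℝ) =
      (((⌊2 * X * D⌋ + 1 - ⌊X * D⌋).toNat : ℤ) : ℝ) := by push_cast; rfl
    rw [h2, h1]
    have h3 := Int.floor_le (2 * X * D)
    have h4 := Int.lt_floor_add_one (X * D)
    nlinarith
  calc (S.card : ℝ) ≤ (P.card * (Z.card * (⌊2 * X * D⌋ + 1 - ⌊X * D⌋).toNat) : ℕ) := by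
        exact_mod_cast hcard
    _ ≤ P.card * (Z.card * ((D + 2) * X)) := by push_cast; gcongr
    _ ≤ _ := by nlinarith

theorem exists_card_zeros_dilate_le {ℓ : ℕ} (hℓ : 1 ≤ ℓ) :
    ∃ C : ℝ, 0 < C ∧ ∀ j : ℕ, 1 ≤ j → j ≤ 2 * ℓ → j ≠ ℓ → ∀ X : ℝ, 8 * ℓ ≤ X → ∀ S : Finset ℂ,
      (∀ ρ ∈ S, (riemannZeta ρ = 0 ∧ 1 / 2 ≤ ρ.re ∧ X ≤ ρ.im ∧ ρ.im ≤ 2 * X) ∧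
        riemannZeta ((j : ℂ) * ρ / (ℓ : ℂ)) = 0) →
      (S.card : ℝ) ≤ C * X := by
  classical
  have hℓ1 : (1 : ℝ) ≤ ℓ := by exact_mod_cast hℓ
  have hℓ0 : (0 : ℝ) < ℓ := by linarith
  set σ : ℝ := 1 / 2 + 1 / (4 * ℓ) with hσ
  obtain ⟨C, hC, h⟩ := exists_card_riemannZeta_zeros_le (σ := σ)
    (by rw [hσ]; have : 0 < 1 / (4 * (ℓ : ℝ)) := by positivity
        linarith)
  refine ⟨2 * C, by positivity, fun j hj1 hj2 hjℓ X hX S hS ↦ ?_⟩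
  have hX8 : 8 ≤ X := by nlinarith
  set k : ℝ := j / ℓ with hk
  have hj1' : (1 : ℝ) ≤ j := by exact_mod_cast hj1
  have hj2' : (j : ℝ) ≤ 2 * ℓ := by exact_mod_cast hj2
  have hk0 : 0 < k := by positivity
  have hk2 : k ≤ 2 := by rw [hk, div_le_iff₀ hℓ0]; exact hj2'
  have hkX : 8 ≤ k * X := by
    have : 1 ≤ k * ℓ := by rw [hk]; field_simp; exact hj1'
    nlinarith
  have he : ∀ ρ : ℂ, (j : ℂ) * ρ / ℓ = (k : ℂ) * ρ := fun ρ ↦ by rw [hk]; push_cast; ring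
  simp only [he] at hS
  rcases lt_or_gt_of_ne hjℓ with hlt | hgt
  · have hkle : k ≤ 1 - 1 / ℓ := by
      have : (j : ℝ) + 1 ≤ ℓ := by exact_mod_cast hlt
      rw [hk, div_le_iff₀ hℓ0, sub_mul, one_div_mul_cancel hℓ0.ne']
      linarith
    have h1 := h X hX8 (S.filter fun ρ ↦ σ ≤ ρ.re) fun z hz ↦ by
      obtain ⟨hz1, hz2⟩ := Finset.mem_filter.mp hz
      obtain ⟨⟨h1, -, h2⟩, -⟩ := hS z hz1
      exact ⟨h1, hz2, h2⟩
    have hinj : Function.Injective fun ρ : ℂ ↦ 1 - (starRingEnd ℂ) (k * ρ) := by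
      intro a b hab
      have := star_injective (sub_right_injective hab)
      exact mul_left_cancel₀ (by exact_mod_cast hk0.ne') this
    have h2 := h (k * X) hkX ((S.filter fun ρ ↦ ¬ σ ≤ ρ.re).image
      fun ρ : ℂ ↦ 1 - (starRingEnd ℂ) (k * ρ)) fun z hz ↦ by
      obtain ⟨ρ, hρ, rfl⟩ := Finset.mem_image.mp hz
      obtain ⟨hz1, hz2⟩ := Finset.mem_filter.mp hρ
      obtain ⟨⟨h1, h2, h3, h4⟩, h5⟩ := hS ρ hz1
      have him : ((k : ℂ) * ρ).im = k * ρ.im := by simp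
      have hre : ((k : ℂ) * ρ).re = k * ρ.re := by simp
      have hpos : 0 < k * ρ.im := mul_pos hk0 (by linarith)
      refine ⟨riemannZeta_one_sub_conj_eq_zero h5 (by rw [him]; exact hpos.ne'), ?_, ?_, ?_⟩
      · rw [sub_re, one_re, conj_re, hre, hσ]
        rw [not_le, hσ] at hz2
        have h6 : 0 ≤ 1 - 1 / (ℓ : ℝ) := hk0.le.trans hkle
        have h7 : k * ρ.re ≤ (1 - 1 / ℓ) * (1 / 2 + 1 / (4 * ℓ)) :=
          mul_le_mul hkle hz2.le (by linarith) h6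
        have h8 : (1 - 1 / ℓ) * (1 / 2 + 1 / (4 * ℓ)) ≤ 1 / 2 - 1 / (4 * (ℓ : ℝ)) := by
          have h9 : 1 / (4 * (ℓ : ℝ)) = 1 / ℓ * (1 / 4) := by field_simp
          have h10 : 0 < 1 / (ℓ : ℝ) := by positivity
          rw [h9]
          nlinarith
        linarith
      · rw [sub_im, one_im, conj_im, him]
        nlinarith
      · rw [sub_im, one_im, conj_im, him]
        nlinarith
    rw [Finset.card_image_of_injective _ hinj] at h2
    have h3 := Finset.card_filter_add_card_filter_not (s := S) fun ρ : ℂ ↦ σ ≤ ρ.re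
    have h4 : (S.card : ℝ) = ((S.filter fun ρ ↦ σ ≤ ρ.re).card : ℝ) +
      ((S.filter fun ρ ↦ ¬ σ ≤ ρ.re).card : ℝ) := by exact_mod_cast h3.symm
    have h5 : k * X ≤ X := by
      have : 0 < 1 / (ℓ : ℝ) := by positivity
      nlinarith
    nlinarith
  · have hkge : 1 + 1 / ℓ ≤ k := by
      have : (ℓ : ℝ) + 1 ≤ j := by exact_mod_cast hgt
      rw [hk, le_div_iff₀ hℓ0, add_mul, one_div_mul_cancel hℓ0.ne']
      linarith
    have hinj : Function.Injective fun ρ : ℂ ↦ (k : ℂ) * ρ :=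
      mul_right_injective₀ (by exact_mod_cast hk0.ne')
    have h2 := h (k * X) hkX (S.image fun ρ : ℂ ↦ (k : ℂ) * ρ) fun z hz ↦ by
      obtain ⟨ρ, hρ, rfl⟩ := Finset.mem_image.mp hz
      obtain ⟨⟨h1, h2, h3, h4⟩, h5⟩ := hS ρ hρ
      have him : ((k : ℂ) * ρ).im = k * ρ.im := by simp
      have hre : ((k : ℂ) * ρ).re = k * ρ.re := by simp
      rw [him, hre]
      refine ⟨h5, ?_, by nlinarith, by nlinarith⟩
      have h9 : 1 / (4 * (ℓ : ℝ)) = 1 / ℓ * (1 / 4) := by field_simp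
      have h10 : 0 < 1 / (ℓ : ℝ) := by positivity
      rw [hσ, h9]
      nlinarith
    rw [Finset.card_image_of_injective _ hinj] at h2
    nlinarith

theorem eventually_exists_riemannZeta_eq_zero_near_of_half_le {K : ℕ} (hK : 4 ≤ K) :
    ∀ᶠ T : ℝ in Filter.atTop, ∃ ρ : ℂ, riemannZeta ρ = 0 ∧ 1 / 2 ≤ ρ.re ∧ |ρ.im - T| < 1 / K := by
  filter_upwards [eventually_exists_riemannZeta_eq_zero_near hK, Filter.eventually_ge_atTop 2]
    with T ⟨ρ, h0, hT⟩ hT2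
  have him : ρ.im ≠ 0 := by
    intro h
    have hK1 : 1 / (K : ℝ) ≤ 1 := by
      have : (4 : ℝ) ≤ K := by exact_mod_cast hK
      rw [div_le_one (by linarith)]
      linarith
    rw [h, abs_lt] at hT
    linarith
  rcases le_or_gt (1 / 2) ρ.re with h | h
  · exact ⟨ρ, h0, h, hT⟩
  · refine ⟨_, riemannZeta_one_sub_conj_eq_zero h0 him, ?_, ?_⟩
    · rw [sub_re, one_re, conj_re]; linarith
    · rwa [sub_im, one_im, conj_im, sub_neg_eq_add, zero_add]

/-- For every `K` the intervals `[X, 2X]` eventually contain the imaginary parts of at least `K * X`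
zeros of `ζ` in the half-plane `re s ≥ 1 / 2`. -/
theorem eventually_exists_finset_riemannZeta_zeros {K : ℕ} (hK : 2 ≤ K) :
    ∀ᶠ X : ℕ in Filter.atTop, ∃ S : Finset ℂ, S.card = X * K ∧
      ∀ ρ ∈ S, riemannZeta ρ = 0 ∧ 1 / 2 ≤ ρ.re ∧ X ≤ ρ.im ∧ ρ.im ≤ 2 * X := by
  obtain ⟨T₀, hT₀⟩ := Filter.eventually_atTop.mp
    (eventually_exists_riemannZeta_eq_zero_near_of_half_le (K := 2 * K) (by omega))
  filter_upwards [tendsto_natCast_atTop_atTop.eventually_ge_atTop T₀] with X hX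
  have hK0 : (0 : ℝ) < K := by exact_mod_cast (by omega : 0 < K)
  have hpos : ∀ i : ℕ, (0 : ℝ) ≤ (2 * i + 1) / (2 * K) := fun i ↦ by positivity
  choose ρ h0 hre him using fun i : ℕ ↦ hT₀ (X + (2 * i + 1) / (2 * K)) (by linarith [hpos i])
  have hmul : ∀ i, |((ρ i).im - X) * K - (i + 1 / 2)| < 1 / 2 := by
    intro i
    have h1 := mul_lt_mul_of_pos_right (him i) hK0
    rw [← abs_of_pos hK0, ← abs_mul, abs_of_pos hK0] at h1
    calc _ = |((ρ i).im - (X + (2 * i + 1) / (2 * K))) * K| := by congr 1; field_simp; ring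
      _ < 1 / ((2 * K : ℕ) : ℝ) * K := h1
      _ = 1 / 2 := by push_cast; field_simp
  have hinj : Function.Injective ρ := by
    intro i j hij
    have h1 := abs_lt.mp (hmul i)
    have h2 := abs_lt.mp (hmul j)
    rw [hij] at h1
    have h3 : (i : ℝ) < j + 1 := by linarith
    have h4 : (j : ℝ) < i + 1 := by linarith
    have h3' : i < j + 1 := by exact_mod_cast h3
    have h4' : j < i + 1 := by exact_mod_cast h4
    omega
  refine ⟨(Finset.range (X * K)).map ⟨ρ, hinj⟩, by simp, fun z hz ↦ ?_⟩
  obtain ⟨i, hi, rfl⟩ := Finset.mem_map.mp hz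
  have hi' : (i : ℝ) + 1 ≤ X * K := by exact_mod_cast Finset.mem_range.mp hi
  have h1 := abs_lt.mp (hmul i)
  have hi0 : (0 : ℝ) ≤ i := Nat.cast_nonneg i
  refine ⟨h0 i, hre i, ?_, ?_⟩
  · change (X : ℝ) ≤ (ρ i).im
    by_contra! hlt
    nlinarith
  · change (ρ i).im ≤ 2 * (X : ℝ)
    by_contra! hlt
    nlinarith

/-- a zero where the other factors do not vanish.
Let `f` be a fake μ whose Dirichlet series factors for `Re s > 1` as
`D_f(s) = U(s) ∏_{j=1}^{2ℓ} ζ(js)^{a_j}` with `a_j ≥ 0` for `j ≤ ℓ-1`,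
`a_ℓ < 0`, and `U(s) = ∏_p (1 + Σ_{j ≥ 2ℓ+1} η_j p^{-js})` with
`|η_j| ≤ (Aj)^B`.  Then there is a nontrivial zero `ρ` of `ζ` with
`Re ρ ≥ 1/2`, `U(ρ/ℓ) ≠ 0`, and `ζ(jρ/ℓ) ≠ 0` for all `1 ≤ j ≤ 2ℓ`, `j ≠ ℓ`. -/
theorem stmt_7 (f : ℕ → ℤ) (ε : ℕ → ℤ)
    (hf1 : f 1 = 1)
    (hmul : ∀ m n : ℕ, Nat.Coprime m n → f (m * n) = f m * f n)
    (hεval : ∀ j : ℕ, 1 ≤ j → ε j = -1 ∨ ε j = 0 ∨ ε j = 1)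
    (hfp : ∀ p : ℕ, Nat.Prime p → ∀ j : ℕ, 1 ≤ j → f (p ^ j) = ε j)
    (ℓ : ℕ) (hℓ : 1 ≤ ℓ)
    (a : ℕ → ℤ) (ha : ∀ j : ℕ, 1 ≤ j → j ≤ ℓ - 1 → 0 ≤ a j) (haℓ : a ℓ < 0)
    (η : ℕ → ℝ) (A B : ℝ) (hA : 0 < A) (hB : 0 < B)
    (hη : ∀ j : ℕ, 2 * ℓ + 1 ≤ j → |η j| ≤ (A * (j : ℝ)) ^ B)
    (hfact : ∀ s : ℂ, 1 < s.re →
      ∑' n : ℕ, (f n : ℂ) / (n : ℂ) ^ s =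
        (∏' p : Nat.Primes,
          (1 + ∑' j : ℕ, (η (j + (2 * ℓ + 1)) : ℂ) *
            ((p : ℕ) : ℂ) ^ (-(((j + (2 * ℓ + 1) : ℕ) : ℂ)) * s))) *
        ∏ j ∈ Finset.Icc 1 (2 * ℓ), riemannZeta ((j : ℂ) * s) ^ (a j)) :
    ∃ ρ : ℂ, riemannZeta ρ = 0 ∧ 0 < ρ.re ∧ ρ.re < 1 ∧ (1 / 2 : ℝ) ≤ ρ.re ∧
      (∏' p : Nat.Primes,
        (1 + ∑' j : ℕ, (η (j + (2 * ℓ + 1)) : ℂ) *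
          ((p : ℕ) : ℂ) ^ (-(((j + (2 * ℓ + 1) : ℕ) : ℂ)) * (ρ / (ℓ : ℂ))))) ≠ 0 ∧
      ∀ j : ℕ, 1 ≤ j → j ≤ 2 * ℓ → j ≠ ℓ → riemannZeta ((j : ℂ) * ρ / (ℓ : ℂ)) ≠ 0 := by
  classical
  obtain ⟨C₁, hC₁, h₁⟩ := exists_card_zeros_tprod_le hℓ hA hη
  obtain ⟨C₂, hC₂, h₂⟩ := exists_card_zeros_dilate_le hℓ
  obtain ⟨K, hK⟩ := exists_nat_gt (C₁ + 2 * ℓ * C₂ + 2)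
  have hpos : 0 ≤ 2 * ℓ * C₂ := by positivity
  have hK2 : 2 ≤ K := by
    have : (2 : ℝ) < K := by linarith
    exact_mod_cast this.le
  obtain ⟨X, ⟨S, hcard, hS⟩, hX⟩ := ((eventually_exists_finset_riemannZeta_zeros hK2).and
    (Filter.eventually_ge_atTop (8 * ℓ))).exists
  have hX' : (8 * ℓ : ℝ) ≤ X := by exact_mod_cast hX
  have hℓ' : (1 : ℝ) ≤ ℓ := by exact_mod_cast hℓ
  by_contra hcon
  set V : ℂ → ℂ := fun ρ ↦ ∏' p : Nat.Primes, (1 + ∑' j : ℕ, (η (j + (2 * ℓ + 1)) : ℂ) *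
    ((p : ℕ) : ℂ) ^ (-(((j + (2 * ℓ + 1) : ℕ) : ℂ)) * (ρ / (ℓ : ℂ)))) with hV
  set J := (Finset.Icc 1 (2 * ℓ)).erase ℓ with hJ
  set W : ℕ → Finset ℂ := fun j ↦
    S.filter fun ρ : ℂ ↦ riemannZeta ((j : ℂ) * ρ / (ℓ : ℂ)) = 0 with hW
  have hcover : S ⊆ S.filter (fun ρ ↦ V ρ = 0) ∪ J.biUnion W := by
    intro ρ hρ
    obtain ⟨h0, hre, him, -⟩ := hS ρ hρ
    obtain ⟨hre0, hre1⟩ := re_mem_Ioo_of_riemannZeta_eq_zero h0 (by linarith)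
    by_contra hnot
    simp only [Finset.mem_union, Finset.mem_filter, Finset.mem_biUnion, hW, hJ, Finset.mem_erase,
      Finset.mem_Icc, not_or, not_and, not_exists] at hnot
    exact hcon ⟨ρ, h0, hre0, hre1, hre, hnot.1 hρ, fun j hj1 hj2 hjℓ ↦
      hnot.2 j ⟨hjℓ, hj1, hj2⟩ hρ⟩
  have hV' : ((S.filter fun ρ ↦ V ρ = 0).card : ℝ) ≤ C₁ * X :=
    h₁ X (by linarith) _ fun ρ hρ ↦ by
      obtain ⟨hρ1, hρ2⟩ := Finset.mem_filter.mp hρ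
      exact ⟨(hS ρ hρ1).2, hρ2⟩
  have hW' : ∀ j ∈ J, ((W j).card : ℝ) ≤ C₂ * X := by
    intro j hj
    simp only [hJ, Finset.mem_erase, Finset.mem_Icc] at hj
    refine h₂ j hj.2.1 hj.2.2 hj.1 X hX' _ fun ρ hρ ↦ ?_
    obtain ⟨hρ1, hρ2⟩ := Finset.mem_filter.mp hρ
    exact ⟨hS ρ hρ1, hρ2⟩
  have hJc : (J.card : ℝ) ≤ 2 * ℓ := by
    have : J.card ≤ 2 * ℓ := (Finset.card_erase_le).trans (by simp)
    exact_mod_cast this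
  have hfinal : (S.card : ℝ) ≤ C₁ * X + 2 * ℓ * (C₂ * X) :=
    calc (S.card : ℝ) ≤ (S.filter fun ρ ↦ V ρ = 0).card + ∑ j ∈ J, ((W j).card : ℝ) := by
          exact_mod_cast (Finset.card_le_card hcover).trans ((Finset.card_union_le _ _).trans
            (Nat.add_le_add_left Finset.card_biUnion_le _))
      _ ≤ C₁ * X + ∑ _j ∈ J, C₂ * X := add_le_add hV' (Finset.sum_le_sum hW')
      _ ≤ C₁ * X + 2 * ℓ * (C₂ * X) := by
          rw [Finset.sum_const, nsmul_eq_mul]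
          gcongr
  rw [hcard, Nat.cast_mul] at hfinal
  nlinarith
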